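/- arXiv:2204.13411 — 6 statements merged into one kernel-verified Lean document; each statement's English description precedes it below -/
import Mathlib

section
/- Let T be a power-bounded linear operator on a complex Banach space X (i.e. sup_{n≥0} ‖T^n‖ < ∞) whose spectrum intersected with the unit circle is contained in {1}. Then ‖T^n (I - T)‖ → 0 as n → ∞. -/
open Filter Topology

namespace KT
open MeasureTheory intervalIntegral

/-- The exponential `e^{ikθ}`. -/
noncomputable def ek (k : ℤ) (t : ℝ) : ℂ := Complex.exp ((k : ℂ) * Complex.I * t)

lemma ek_cont (k : ℤ) : Continuous (ek k) := by unfold ek; fun_prop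

lemma ek_norm (k : ℤ) (t : ℝ) : ‖ek k t‖ = 1 := by
  unfold ek
  rw [show (k : ℂ) * Complex.I * t = ((k * t : ℝ) : ℂ) * Complex.I by push_cast; ring]
  exact Complex.norm_exp_ofReal_mul_I _

lemma ek_deriv (k : ℤ) (t : ℝ) : HasDerivAt (ek k) ((k : ℂ) * Complex.I * ek k t) t := by
  unfold ek
  have h := ((Complex.ofRealCLM.hasDerivAt (x := t)).const_mul ((k : ℂ) * Complex.I)).cexp
  simpa [mul_comm, mul_left_comm, mul_assoc] using h

lemma ek_add (k l : ℤ) (t : ℝ) : ek (k + l) t = ek k t * ek l t := by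
  unfold ek
  rw [← Complex.exp_add]; congr 1; push_cast; ring

lemma ek_zero (t : ℝ) : ek 0 t = 1 := by simp [ek]

lemma int_ek (k : ℤ) : ∫ t in (-Real.pi)..Real.pi, ek k t = if k = 0 then (2 * Real.pi : ℂ) else 0 := by
  split_ifs with h
  · subst h; simp [ek_zero]; ring
  · have hk : (k : ℂ) * Complex.I ≠ 0 := by simp [h]
    unfold ek
    rw [integral_exp_mul_complex hk]
    have : Complex.exp ((k : ℂ) * Complex.I * (Real.pi : ℝ))
        = Complex.exp ((k : ℂ) * Complex.I * ((-Real.pi : ℝ) : ℂ)) := by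
      rw [Complex.exp_eq_exp_iff_exists_int]
      exact ⟨k, by push_cast; ring⟩
    rw [this]; simp

lemma ibp (f f' : ℝ → ℂ) (hf : ∀ t, HasDerivAt f (f' t) t) (hc : Continuous f')
    (h1 : f (-Real.pi) = 0) (h2 : f Real.pi = 0) (k : ℤ) :
    ‖∫ t in (-Real.pi)..Real.pi, f t * ek k t‖ * |(k : ℝ)|
      = ‖∫ t in (-Real.pi)..Real.pi, f' t * ek k t‖ := by
  have h := integral_mul_deriv_eq_deriv_mul (a := -Real.pi) (b := Real.pi) (u := f) (u' := f')
    (v := ek k) (v' := fun t => (k : ℂ) * Complex.I * ek k t)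
    (fun x _ => hf x) (fun x _ => ek_deriv k x) (hc.intervalIntegrable _ _)
    ((continuous_const.mul (ek_cont k)).intervalIntegrable _ _)
  rw [h1, h2] at h
  simp only [zero_mul, sub_zero, zero_sub] at h
  rw [← norm_neg (∫ t in (-Real.pi)..Real.pi, f' t * ek k t), ← h]
  rw [← norm_mul_comm_aux k, ← norm_mul, ← intervalIntegral.integral_mul_const]
  congr 2; ext t; ring
where
  norm_mul_comm_aux (k : ℤ) : ‖(k : ℂ) * Complex.I‖ = |(k : ℝ)| := by simp

lemma small_int (f : ℝ → ℂ) (d B : ℝ) (hd : 0 < d) (hd1 : d ≤ 1)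
    (h0 : ∀ t, 2 * d ≤ |t| → f t = 0) (hB : ∀ t, |t| ≤ 2 * d → ‖f t‖ ≤ B) (k : ℤ) :
    ‖∫ t in (-Real.pi)..Real.pi, f t * ek k t‖ ≤ B * (4 * d) := by
  have hpi := Real.pi_gt_three
  have hs : ∀ a, 2 * d ≤ a → Function.support (fun t => f t * ek k t) ⊆ Set.Ioc (-a) a := by
    intro a ha t ht
    have : ¬ 2 * d ≤ |t| := fun h => ht (by simp [h0 t h])
    rw [not_le, abs_lt] at this
    exact ⟨by linarith, by linarith⟩
  rw [integral_eq_integral_of_support_subset (hs _ (by linarith)),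
    ← integral_eq_integral_of_support_subset (hs (2 * d) le_rfl)]
  have := intervalIntegral.norm_integral_le_of_norm_le_const (a := -(2 * d)) (b := 2 * d)
    (f := fun t => f t * ek k t) (C := B) (by
      intro t ht
      rw [Set.uIoc_of_le (by linarith)] at ht
      rw [norm_mul, ek_norm, mul_one]
      exact hB t (abs_le.2 ⟨ht.1.le, ht.2⟩))
  refine this.trans (le_of_eq ?_)
  rw [abs_of_pos (by linarith)]; ring

lemma exists_bump : ∃ (p p1 p2 : ℝ → ℂ) (C : ℝ), (∀ t, HasDerivAt p (p1 t) t) ∧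
    (∀ t, HasDerivAt p1 (p2 t) t) ∧ Continuous p2 ∧ (∀ t, |t| ≤ 1 → p t = 1) ∧
    (∀ t, 2 ≤ |t| → p t = 0 ∧ p1 t = 0 ∧ p2 t = 0) ∧
    (∀ t, ‖p t‖ ≤ C ∧ ‖p1 t‖ ≤ C ∧ ‖p2 t‖ ≤ C) := by
  let b : ContDiffBump (0 : ℝ) := ⟨1, 3/2, by norm_num, by norm_num⟩
  let p : ℝ → ℂ := fun t => (b t : ℂ)
  have hp : ContDiff ℝ 3 p := Complex.ofRealCLM.contDiff.comp b.contDiff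
  have hp1 : ContDiff ℝ 2 (deriv p) := by
    have : ContDiff ℝ (2 + 1) p := by convert! hp
    exact (contDiff_succ_iff_deriv.1 this).2.2
  have hp2 : ContDiff ℝ 1 (deriv (deriv p)) := by
    have : ContDiff ℝ (1 + 1) (deriv p) := by convert! hp1
    exact (contDiff_succ_iff_deriv.1 this).2.2
  have hcs : HasCompactSupport p := b.hasCompactSupport.comp_left (g := ((↑) : ℝ → ℂ)) (by simp)
  have hz : ∀ t : ℝ, 2 ≤ |t| → p =ᶠ[𝓝 t] fun _ => 0 := by
    intro t ht
    have : ∀ᶠ s : ℝ in 𝓝 t, 3/2 < |s| :=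
      continuous_abs.continuousAt.eventually_const_lt (by linarith)
    filter_upwards [this] with s hs
    have : b s = 0 := b.zero_of_le_dist (by simpa using hs.le)
    simp [p, this]
  obtain ⟨C0, h0⟩ := hp.continuous.bounded_above_of_compact_support hcs
  obtain ⟨C1, h1⟩ := hp1.continuous.bounded_above_of_compact_support hcs.deriv
  obtain ⟨C2, h2⟩ := hp2.continuous.bounded_above_of_compact_support hcs.deriv.deriv
  refine ⟨p, deriv p, deriv (deriv p), max C0 (max C1 C2), fun t => ?_, fun t => ?_,
    hp2.continuous, fun t ht => ?_, fun t ht => ⟨(hz t ht).eq_of_nhds, ?_, ?_⟩, fun t => ⟨?_, ?_, ?_⟩⟩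
  · exact (hp.differentiable (by norm_num) t).hasDerivAt
  · exact (hp1.differentiable (by norm_num) t).hasDerivAt
  · have : b t = 1 := b.one_of_mem_closedBall (by simpa using ht)
    simp [p, this]
  · rw [(hz t ht).deriv_eq]; simp
  · rw [(hz t ht).deriv.deriv_eq]; simp
  · exact (h0 t).trans (by simp)
  · exact (h1 t).trans (by simp)
  · exact (h2 t).trans (by simp)

lemma norm_one_sub_ek (t : ℝ) : ‖1 - ek 1 t‖ ≤ |t| := by
  rw [norm_sub_rev]
  have := Real.norm_exp_I_mul_ofReal_sub_one_le (x := t)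
  simpa [ek] using this

lemma exists_g (e : ℝ) (he : 0 < e) : ∃ (g : ℝ → ℂ) (d : ℝ), Continuous g ∧ 0 < d ∧
    (∀ t, |t| ≤ d → g t = 0) ∧ ∀ s : Finset ℤ,
      ∑ k ∈ s, ‖∫ t in (-Real.pi)..Real.pi, (1 - ek 1 t - g t) * ek k t‖ ≤ e := by
  obtain ⟨p, p1, p2, C, hp, hp1, hc2, hone, hzero, hC⟩ := exists_bump
  have hC0 : 0 ≤ C := (norm_nonneg _).trans (hC 0).1
  have hpc : Continuous p := continuous_iff_continuousAt.2 fun t => (hp t).continuousAt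
  have hp1c : Continuous p1 := continuous_iff_continuousAt.2 fun t => (hp1 t).continuousAt
  let h : ℝ → ℝ → ℂ := fun d t => p (d⁻¹ * t) * (1 - ek 1 t)
  let a : ℝ → ℤ → ℝ := fun d k => ‖∫ t in (-Real.pi)..Real.pi, h d t * ek k t‖
  have habs : ∀ d t : ℝ, 0 < d → 2 * d ≤ |t| → 2 ≤ |d⁻¹ * t| := by
    intro d t hd ht
    rw [abs_mul, abs_inv, abs_of_pos hd, inv_mul_eq_div, le_div_iff₀ hd]; exact ht
  have hA : ∀ d k, 0 < d → d ≤ 1 → a d k ≤ 8 * C * d := by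
    intro d k hd hd1
    have := small_int (h d) d (C * 2) hd hd1 (fun t ht => by
      simp [h, (hzero _ (habs d t hd ht)).1]) (fun t ht => by
        simp only [h, norm_mul]
        gcongr
        · exact (hC _).1
        · exact (norm_one_sub_ek t).trans (ht.trans (by linarith))) k
    calc a d k ≤ _ := this
      _ = _ := by ring
  have hpi := Real.pi_gt_three
  have hB : ∀ d k, 0 < d → d ≤ 1 → a d k * (k : ℝ) ^ 2 ≤ 20 * C := by
    intro d k hd hd1
    have hinv : ∀ (q q' : ℝ → ℂ), (∀ t, HasDerivAt q (q' t) t) → ∀ t,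
        HasDerivAt (fun t : ℝ => q (d⁻¹ * t)) ((d⁻¹ : ℂ) * q' (d⁻¹ * t)) t := by
      intro q q' hq t
      have := (hq (d⁻¹ * t)).scomp t ((hasDerivAt_id t).const_mul d⁻¹)
      simpa [Function.comp_def] using this
    have hE : ∀ t, HasDerivAt (fun t => 1 - ek 1 t) (-(Complex.I * ek 1 t)) t := by
      intro t
      simpa using (ek_deriv 1 t).const_sub 1
    have hE2 : ∀ t, HasDerivAt (fun t => -(Complex.I * ek 1 t))
        (-(Complex.I * (Complex.I * ek 1 t))) t := by
      intro t
      simpa using ((ek_deriv 1 t).const_mul Complex.I).fun_neg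
    let h1 : ℝ → ℂ := fun t => (d⁻¹ : ℂ) * p1 (d⁻¹ * t) * (1 - ek 1 t)
      + p (d⁻¹ * t) * (-(Complex.I * ek 1 t))
    let h2 : ℝ → ℂ := fun t => ((d⁻¹ : ℂ) * ((d⁻¹ : ℂ) * p2 (d⁻¹ * t))) * (1 - ek 1 t)
      + (d⁻¹ : ℂ) * p1 (d⁻¹ * t) * (-(Complex.I * ek 1 t))
      + ((d⁻¹ : ℂ) * p1 (d⁻¹ * t) * (-(Complex.I * ek 1 t))
        + p (d⁻¹ * t) * (-(Complex.I * (Complex.I * ek 1 t))))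
    have hh1 : ∀ t, HasDerivAt (h d) (h1 t) t := fun t => (hinv p p1 hp t).mul (hE t)
    have hh2 : ∀ t, HasDerivAt h1 (h2 t) t := fun t =>
      (((hinv p1 p2 hp1 t).const_mul _).mul (hE t)).add ((hinv p p1 hp t).mul
        (hE2 t))
    have e1 := ek_cont 1
    have c1 : Continuous h1 := by fun_prop
    have c2 : Continuous h2 := by fun_prop
    have z0 : ∀ t, 2 * d ≤ |t| → h d t = 0 := fun t ht => by
      simp [h, (hzero _ (habs d t hd ht)).1]
    have z1 : ∀ t, 2 * d ≤ |t| → h1 t = 0 := fun t ht => by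
      simp [h1, hzero _ (habs d t hd ht)]
    have z2 : ∀ t, 2 * d ≤ |t| → h2 t = 0 := fun t ht => by
      simp [h2, hzero _ (habs d t hd ht)]
    have b1 : 2 * d ≤ |Real.pi| := by rw [abs_of_pos (by linarith)]; linarith
    have b2 : 2 * d ≤ |-Real.pi| := by rwa [abs_neg]
    have i1 := ibp (h d) h1 hh1 c1 (z0 _ b2) (z0 _ b1) k
    have i2 := ibp h1 h2 hh2 c2 (z1 _ b2) (z1 _ b1) k
    have hnd : ‖(d⁻¹ : ℂ)‖ = d⁻¹ := by
      rw [norm_inv, Complex.norm_real, Real.norm_of_nonneg hd.le]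
    have hdi : 1 ≤ d⁻¹ := (one_le_inv₀ hd).2 hd1
    have bd : ∀ t, |t| ≤ 2 * d → ‖h2 t‖ ≤ 5 * C * d⁻¹ := by
      intro t ht
      obtain ⟨q0, q1, q2⟩ := hC (d⁻¹ * t)
      have n1 : ‖((d⁻¹ : ℂ) * ((d⁻¹ : ℂ) * p2 (d⁻¹ * t))) * (1 - ek 1 t)‖ ≤ 2 * C * d⁻¹ := by
        rw [norm_mul, norm_mul, norm_mul, hnd]
        calc d⁻¹ * (d⁻¹ * ‖p2 (d⁻¹ * t)‖) * ‖1 - ek 1 t‖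
            ≤ d⁻¹ * (d⁻¹ * C) * (2 * d) := by
              gcongr
              exact (norm_one_sub_ek t).trans ht
          _ = _ := by field_simp
      have n2 : ‖(d⁻¹ : ℂ) * p1 (d⁻¹ * t) * (-(Complex.I * ek 1 t))‖ ≤ C * d⁻¹ := by
        rw [norm_mul, norm_mul, hnd, norm_neg, norm_mul, ek_norm, Complex.norm_I]
        calc d⁻¹ * ‖p1 (d⁻¹ * t)‖ * (1 * 1) ≤ d⁻¹ * C * (1 * 1) := by gcongr
          _ = _ := by ring
      have n3 : ‖p (d⁻¹ * t) * (-(Complex.I * (Complex.I * ek 1 t)))‖ ≤ C * d⁻¹ := by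
        rw [norm_mul, norm_neg, norm_mul, norm_mul, ek_norm, Complex.norm_I]
        calc ‖p (d⁻¹ * t)‖ * (1 * (1 * 1)) ≤ C * 1 := by linarith
          _ ≤ _ := by gcongr
      have := norm_add_le_of_le (norm_add_le_of_le n1 n2) (norm_add_le_of_le n2 n3)
      calc ‖h2 t‖ ≤ _ := this
        _ = _ := by ring
    have := small_int h2 d _ hd hd1 z2 bd k
    calc a d k * (k : ℝ) ^ 2 = (a d k * |(k : ℝ)|) * |(k : ℝ)| := by
          rw [mul_assoc, ← sq, sq_abs]
      _ = ‖∫ t in (-Real.pi)..Real.pi, h2 t * ek k t‖ := by rw [← i2, ← i1]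
      _ ≤ _ := this
      _ = _ := by field_simp; ring
  -- dominated convergence
  let bnd : ℤ → ℝ := fun k => 20 * C * (1 / (k : ℝ) ^ 2) + if k = 0 then 8 * C else 0
  have hbs : Summable bnd := by
    refine ((Real.summable_one_div_int_pow.2 (by norm_num)).mul_left _).add ?_
    exact summable_of_ne_finset_zero (s := {0}) (fun k hk => by simp at hk; simp [hk])
  let D : ℕ → ℝ := fun n => 1 / ((n : ℝ) + 1)
  have hD0 : ∀ n, 0 < D n := fun n => by positivity
  have hD1 : ∀ n, D n ≤ 1 := fun n => by
    simp only [D]; rw [div_le_one (by positivity)]; simp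
  have hDt : Tendsto D atTop (𝓝 0) := tendsto_one_div_add_atTop_nhds_zero_nat
  have hle : ∀ n k, a (D n) k ≤ bnd k := by
    intro n k
    by_cases hk : k = 0
    · subst hk
      have := hA (D n) 0 (hD0 n) (hD1 n)
      simp only [bnd]
      simp only [Int.cast_zero, if_true]
      norm_num
      nlinarith [hD1 n]
    · have := hB (D n) k (hD0 n) (hD1 n)
      have hk2 : (0:ℝ) < (k : ℝ) ^ 2 := by positivity
      simp only [bnd, hk, if_false, add_zero, mul_one_div]
      rwa [le_div_iff₀ hk2]
  have hnn : ∀ d k, 0 ≤ a d k := fun d k => norm_nonneg _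
  have ht : Tendsto (fun n => ∑' k, a (D n) k) atTop (𝓝 (∑' _ : ℤ, (0:ℝ))) := by
    refine tendsto_tsum_of_dominated_convergence hbs (fun k => ?_) (Eventually.of_forall fun n k => ?_)
    · refine squeeze_zero (fun n => hnn _ _) (fun n => hA (D n) k (hD0 n) (hD1 n)) ?_
      simpa using hDt.const_mul (8 * C)
    · rw [Real.norm_of_nonneg (hnn _ _)]; exact hle n k
  rw [tsum_zero] at ht
  obtain ⟨n, hn⟩ := (ht.eventually_le_const he).exists
  have e1 := ek_cont 1
  refine ⟨fun t => 1 - ek 1 t - h (D n) t, D n, by fun_prop, hD0 n, fun t ht => ?_, fun s => ?_⟩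
  · have : p ((D n)⁻¹ * t) = 1 := hone _ (by
      rw [abs_mul, abs_inv, abs_of_pos (hD0 n), inv_mul_eq_div, div_le_one (hD0 n)]; exact ht)
    simp [h, this]
  · simp only [sub_sub_cancel]
    have hs : Summable (a (D n)) := Summable.of_nonneg_of_le (hnn _) (hle n) hbs
    exact (hs.sum_le_tsum s (fun k _ => hnn _ k)).trans hn

lemma RL {E : Type*} [NormedAddCommGroup E] [NormedSpace ℂ E] (G : ℝ → E) (u : ℕ → ℤ)
    (hu : Tendsto (fun n => |(u n : ℝ)|) atTop atTop) :
    Tendsto (fun n => ∫ t in (-Real.pi)..Real.pi, ek (u n) t • G t) atTop (𝓝 0) := by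
  have hpi := Real.pi_pos
  have h := Real.tendsto_integral_exp_smul_cocompact
    (Set.indicator (Set.Ioc (-Real.pi) Real.pi) G)
  have hw : Tendsto (fun n => -(u n : ℝ) / (2 * Real.pi)) atTop (cocompact ℝ) := by
    rw [← Metric.cobounded_eq_cocompact, ← tendsto_norm_atTop_iff_cobounded]
    have := hu.atTop_div_const (show 0 < 2 * Real.pi by positivity)
    refine this.congr fun n => ?_
    rw [norm_div, norm_neg, Real.norm_eq_abs, Real.norm_of_nonneg (by positivity)]
  refine (h.comp hw).congr fun n => ?_
  simp only [Function.comp_apply]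
  rw [intervalIntegral.integral_of_le (by linarith), ← MeasureTheory.integral_indicator measurableSet_Ioc]
  congr 1; ext t
  by_cases ht : t ∈ Set.Ioc (-Real.pi) Real.pi
  · rw [Set.indicator_of_mem ht, Set.indicator_of_mem ht, Circle.smul_def, Real.fourierChar_apply]
    congr 1
    unfold ek
    congr 1
    push_cast
    have : (Real.pi : ℂ) ≠ 0 := by exact_mod_cast hpi.ne'
    field_simp
  · rw [Set.indicator_of_notMem ht, Set.indicator_of_notMem ht, smul_zero]

lemma ek_one_ne (t : ℝ) (ht : t ∈ Set.Icc (-Real.pi) Real.pi) (h0 : t ≠ 0) : ek 1 t ≠ 1 := by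
  unfold ek
  rw [Ne, Complex.exp_eq_one_iff]
  rintro ⟨n, hn⟩
  have h1 : (t : ℂ) = ((n * (2 * Real.pi) : ℝ) : ℂ) := by
    have : Complex.I * (t : ℂ) = Complex.I * ((n * (2 * Real.pi) : ℝ) : ℂ) := by
      push_cast at hn ⊢; rw [one_mul] at hn; rw [hn]; ring
    exact mul_left_cancel₀ Complex.I_ne_zero this
  have h2 : t = n * (2 * Real.pi) := by exact_mod_cast h1
  have hpi := Real.pi_pos
  have hn0 : n ≠ 0 := by rintro rfl; simp at h2; exact h0 h2
  have : (1:ℝ) ≤ |(n:ℝ)| := by exact_mod_cast Int.one_le_abs hn0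
  have h3 : |t| = |(n:ℝ)| * (2 * Real.pi) := by
    rw [h2, abs_mul, abs_of_pos (show 0 < 2 * Real.pi by positivity)]
  have h4 : |t| ≤ Real.pi := abs_le.2 ht
  nlinarith

lemma main_id {A : Type*} [NormedRing A] [NormedAlgebra ℂ A] [CompleteSpace A] (T : A)
    (G : ℝ → A) (g : ℝ → ℂ) (hg : Continuous g)
    (hG : ContinuousOn G (Set.Icc (-Real.pi) Real.pi))
    (hGg : ∀ t ∈ Set.Icc (-Real.pi) Real.pi, ek 1 t • G t - T * G t = g t • (1 : A))
    (n : ℤ) (M : ℕ) :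
    ∫ t in (-Real.pi)..Real.pi, ek (n + 1) t • G t =
      ∑ m ∈ Finset.range M, (∫ t in (-Real.pi)..Real.pi, g t * ek (n - m) t) • T ^ m
      + T ^ M * ∫ t in (-Real.pi)..Real.pi, ek (n + 1 - M) t • G t := by
  have hle : -Real.pi ≤ Real.pi := by linarith [Real.pi_pos]
  have hint : ∀ k, IntervalIntegrable (fun t => ek k t • G t) volume (-Real.pi) Real.pi := by
    intro k
    apply ContinuousOn.intervalIntegrable
    rw [Set.uIcc_of_le hle]
    exact (ek_cont k).continuousOn.smul hG
  induction M with
  | zero => simp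
  | succ M ih =>
    rw [ih, Finset.sum_range_succ, add_assoc]
    congr 1
    have key : ∫ t in (-Real.pi)..Real.pi, ek (n + 1 - M) t • G t
        = (∫ t in (-Real.pi)..Real.pi, g t * ek (n - M) t) • (1 : A)
          + T * ∫ t in (-Real.pi)..Real.pi, ek (n + 1 - (M + 1 : ℕ)) t • G t := by
      have e : ∀ f : ℝ → A, IntervalIntegrable f volume (-Real.pi) Real.pi →
          T * ∫ t in (-Real.pi)..Real.pi, f t = ∫ t in (-Real.pi)..Real.pi, T * f t :=
        fun f hf => ((ContinuousLinearMap.mul ℂ A T).intervalIntegral_comp_comm hf).symm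
      rw [e _ (hint _), ← intervalIntegral.integral_smul_const, ← intervalIntegral.integral_add]
      · apply intervalIntegral.integral_congr
        intro t ht
        rw [Set.uIcc_of_le hle] at ht
        have h1 := hGg t ht
        have e1 : n + 1 - (M : ℤ) = (n - M) + 1 := by ring
        have e2 : n + 1 - ((M + 1 : ℕ) : ℤ) = n - M := by push_cast; ring
        simp only
        rw [e1, e2, ek_add, mul_smul, mul_smul_comm, mul_comm (g t), mul_smul, ← smul_add, ← h1]
        simp
      · exact ((hg.mul (ek_cont _)).smul continuous_const).intervalIntegrable _ _
      · apply ContinuousOn.intervalIntegrable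
        rw [Set.uIcc_of_le hle]
        exact continuousOn_const.mul ((ek_cont _).continuousOn.smul hG)
    rw [key, mul_add, mul_smul_comm, mul_one, pow_succ, mul_assoc]

lemma int_c (k : ℤ) : ∫ t in (-Real.pi)..Real.pi, (1 - ek 1 t) * ek k t
    = (if k = 0 then (2 * Real.pi : ℂ) else 0) - (if k = -1 then (2 * Real.pi : ℂ) else 0) := by
  have : ∀ t, (1 - ek 1 t) * ek k t = ek k t - ek (k + 1) t := by
    intro t; rw [ek_add]; ring
  simp only [this]
  rw [intervalIntegral.integral_sub ((ek_cont _).intervalIntegrable _ _)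
    ((ek_cont _).intervalIntegrable _ _), int_ek, int_ek]
  congr 2
  simp [eq_neg_iff_add_eq_zero]

lemma main_bound {A : Type*} [NormedRing A] [NormedAlgebra ℂ A] [CompleteSpace A] (T : A)
    (K : ℝ) (hK : ∀ n : ℕ, ‖T ^ n‖ ≤ K)
    (G : ℝ → A) (g : ℝ → ℂ) (hg : Continuous g)
    (hG : ContinuousOn G (Set.Icc (-Real.pi) Real.pi))
    (hGg : ∀ t ∈ Set.Icc (-Real.pi) Real.pi, ek 1 t • G t - T * G t = g t • (1 : A))
    (e : ℝ) (he : ∀ s : Finset ℤ,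
      ∑ k ∈ s, ‖∫ t in (-Real.pi)..Real.pi, (1 - ek 1 t - g t) * ek k t‖ ≤ e) (n : ℕ) :
    2 * Real.pi * ‖T ^ n * (1 - T)‖ ≤
      ‖∫ t in (-Real.pi)..Real.pi, ek (n + 1) t • G t‖ + e * K := by
  have hK0 : 0 ≤ K := (norm_nonneg _).trans (hK 0)
  have hpi := Real.pi_pos
  have step : ∀ M : ℕ, n + 2 ≤ M → 2 * Real.pi * ‖T ^ n * (1 - T)‖ ≤
      ‖∫ t in (-Real.pi)..Real.pi, ek (n + 1) t • G t‖ + e * K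
        + K * ‖∫ t in (-Real.pi)..Real.pi, ek (n + 1 - M) t • G t‖ := by
    intro M hM
    have hid := main_id T G g hg hG hGg n M
    have hc : ∑ m ∈ Finset.range M,
        (∫ t in (-Real.pi)..Real.pi, (1 - ek 1 t) * ek (n - m) t) • T ^ m
        = (2 * Real.pi : ℂ) • (T ^ n * (1 - T)) := by
      have : ∀ m ∈ Finset.range M,
          (∫ t in (-Real.pi)..Real.pi, (1 - ek 1 t) * ek (n - m) t) • T ^ m
          = (if m = n then (2 * Real.pi : ℂ) • T ^ m else 0)
            - (if m = n + 1 then (2 * Real.pi : ℂ) • T ^ m else 0) := by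
        intro m _
        rw [int_c, sub_smul]
        have a1 : ((n : ℤ) - m = 0) ↔ m = n := by omega
        have a2 : ((n : ℤ) - m = -1) ↔ m = n + 1 := by omega
        simp only [a1, a2, ite_smul, zero_smul]
      rw [Finset.sum_congr rfl this, Finset.sum_sub_distrib, Finset.sum_ite_eq',
        Finset.sum_ite_eq', if_pos (by simp; omega), if_pos (by simp; omega), mul_sub, mul_one,
        smul_sub, pow_succ]
    have hdiff : ∑ m ∈ Finset.range M,
        (∫ t in (-Real.pi)..Real.pi, (1 - ek 1 t - g t) * ek (n - m) t) • T ^ m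
        = (2 * Real.pi : ℂ) • (T ^ n * (1 - T)) - ∑ m ∈ Finset.range M,
        (∫ t in (-Real.pi)..Real.pi, g t * ek (n - m) t) • T ^ m := by
      rw [← hc, ← Finset.sum_sub_distrib]
      refine Finset.sum_congr rfl fun m _ => ?_
      rw [← sub_smul, ← intervalIntegral.integral_sub]
      · congr 2; ext t; ring
      · exact ((continuous_const.sub (ek_cont _)).mul (ek_cont _)).intervalIntegrable _ _
      · exact (hg.mul (ek_cont _)).intervalIntegrable _ _
    have hsum : ‖∑ m ∈ Finset.range M,
        (∫ t in (-Real.pi)..Real.pi, (1 - ek 1 t - g t) * ek (n - m) t) • T ^ m‖ ≤ e * K := by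
      calc _ ≤ ∑ m ∈ Finset.range M,
            ‖∫ t in (-Real.pi)..Real.pi, (1 - ek 1 t - g t) * ek (n - m) t‖ * K := by
            refine norm_sum_le_of_le _ fun m _ => ?_
            rw [norm_smul]
            gcongr
            exact hK m
        _ ≤ e * K := by
            rw [← Finset.sum_mul]
            gcongr
            have inj : Set.InjOn (fun m : ℕ => (n : ℤ) - m) (Finset.range M : Set ℕ) := by
              intro x _ y _ hxy
              simp only at hxy
              omega
            have := he ((Finset.range M).image (fun m : ℕ => (n : ℤ) - m))
            rwa [Finset.sum_image inj] at this
    have heq : (2 * Real.pi : ℂ) • (T ^ n * (1 - T))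
        = (∫ t in (-Real.pi)..Real.pi, ek (n + 1) t • G t)
          + ∑ m ∈ Finset.range M,
            (∫ t in (-Real.pi)..Real.pi, (1 - ek 1 t - g t) * ek (n - m) t) • T ^ m
          - T ^ M * ∫ t in (-Real.pi)..Real.pi, ek (n + 1 - M) t • G t := by
      rw [hdiff, hid]; abel
    have hn : ‖(2 * Real.pi : ℂ) • (T ^ n * (1 - T))‖ = 2 * Real.pi * ‖T ^ n * (1 - T)‖ := by
      rw [norm_smul]; simp [abs_of_pos hpi]
    rw [← hn, heq]
    refine (norm_sub_le _ _).trans (add_le_add ((norm_add_le _ _).trans (by gcongr)) ?_)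
    exact (norm_mul_le _ _).trans (by gcongr; exact hK M)
  have hlim : Tendsto (fun M : ℕ => ∫ t in (-Real.pi)..Real.pi, ek (n + 1 - M) t • G t)
      atTop (𝓝 0) := by
    refine RL G (fun M : ℕ => (n : ℤ) + 1 - M) ?_
    apply tendsto_abs_atBot_atTop.comp
    push_cast
    exact (tendsto_const_nhds (x := (n : ℝ) + 1)).add_atBot (tendsto_neg_atTop_atBot.comp tendsto_natCast_atTop_atTop)
      |>.congr fun M => by simp [sub_eq_add_neg]
  have hlim2 := (hlim.norm.const_mul K).const_add
    (‖∫ t in (-Real.pi)..Real.pi, ek (n + 1) t • G t‖ + e * K)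
  rw [norm_zero, mul_zero, add_zero] at hlim2
  exact ge_of_tendsto hlim2 (eventually_atTop.2 ⟨n + 2, step⟩)

lemma exists_G {A : Type*} [NormedRing A] [NormedAlgebra ℂ A] [CompleteSpace A] (T : A)
    (hspec : ∀ z ∈ spectrum ℂ T, ‖z‖ = 1 → z = 1) (g : ℝ → ℂ) (hg : Continuous g)
    (d : ℝ) (hd : 0 < d) (h0 : ∀ t, |t| ≤ d → g t = 0) :
    ∃ G : ℝ → A, ContinuousOn G (Set.Icc (-Real.pi) Real.pi) ∧
      ∀ t ∈ Set.Icc (-Real.pi) Real.pi, ek 1 t • G t - T * G t = g t • (1 : A) := by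
  have hres : ∀ t ∈ Set.Icc (-Real.pi) Real.pi, t ≠ 0 → ek 1 t ∈ resolventSet ℂ T := by
    intro t ht ht0
    by_contra hcon
    exact ek_one_ne t ht ht0 (hspec _ hcon (ek_norm 1 t))
  refine ⟨fun t => g t • resolvent T (ek 1 t), fun t ht => ?_, fun t ht => ?_⟩
  · by_cases ht0 : t = 0
    · subst ht0
      have : (fun t => g t • resolvent T (ek 1 t)) =ᶠ[𝓝 0] fun _ => 0 := by
        filter_upwards [Metric.ball_mem_nhds (0:ℝ) hd] with s hs
        rw [h0 s (by simpa using (Metric.mem_ball.1 hs).le), zero_smul]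
      exact (continuousAt_const.congr this.symm).continuousWithinAt
    · have c := (spectrum.hasDerivAt_resolvent_const_left (hres t ht ht0)).continuousAt
      exact (hg.continuousAt.smul (c.comp (ek_cont 1).continuousAt)).continuousWithinAt
  · by_cases ht0 : t = 0
    · subst ht0
      simp [h0 0 (by simpa using hd.le)]
    · have hu := hres t ht ht0
      have : (algebraMap ℂ A (ek 1 t) - T) * resolvent T (ek 1 t) = 1 :=
        Ring.mul_inverse_cancel _ hu
      simp only
      rw [← this, sub_mul, smul_sub, Algebra.algebraMap_eq_smul_one, smul_mul_assoc, one_mul,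
        mul_smul_comm, smul_comm]

theorem main {A : Type*} [NormedRing A] [NormedAlgebra ℂ A] [CompleteSpace A] (T : A)
    (hpb : ∃ K : ℝ, ∀ n : ℕ, ‖T ^ n‖ ≤ K)
    (hspec : ∀ z ∈ spectrum ℂ T, ‖z‖ = 1 → z = 1) :
    Tendsto (fun n : ℕ => ‖T ^ n * (1 - T)‖) atTop (𝓝 0) := by
  obtain ⟨K, hK⟩ := hpb
  have hK0 : 0 ≤ K := (norm_nonneg _).trans (hK 0)
  have hpi := Real.pi_gt_three
  rw [Metric.tendsto_atTop]
  intro e he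
  obtain ⟨g, d, hg, hd, hg0, hs⟩ := exists_g (e / (K + 1)) (by positivity)
  obtain ⟨G, hGc, hGg⟩ := exists_G T hspec g hg d hd hg0
  have hb := main_bound T K hK G g hg hGc hGg _ hs
  have hlim : Tendsto (fun n : ℕ => ∫ t in (-Real.pi)..Real.pi, ek (n + 1) t • G t)
      atTop (𝓝 0) := by
    refine RL G (fun n : ℕ => (n : ℤ) + 1) ?_
    apply tendsto_abs_atTop_atTop.comp
    push_cast
    exact tendsto_natCast_atTop_atTop.atTop_add tendsto_const_nhds
  have hl := hlim.norm
  rw [norm_zero] at hl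
  obtain ⟨N, hN⟩ := eventually_atTop.1 (hl.eventually_lt_const he)
  refine ⟨N, fun n hn => ?_⟩
  rw [dist_zero_right, norm_norm]
  have h1 := hN n hn
  have h2 := hb n
  have h3 : e / (K + 1) * K ≤ e := by
    rw [div_mul_eq_mul_div, div_le_iff₀ (by positivity)]; nlinarith
  have h4 : 0 ≤ ‖T ^ n * (1 - T)‖ := norm_nonneg _
  nlinarith

end KT

/-- Katznelson–Tzafriri theorem: if `T` is power-bounded and its unitary spectrum is
contained in `{1}`, then `‖T^n (I - T)‖ → 0`. -/
theorem stmt0 {X : Type*} [NormedAddCommGroup X] [NormedSpace ℂ X] [CompleteSpace X]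
    (T : X →L[ℂ] X) (hpb : ∃ K : ℝ, ∀ n : ℕ, ‖T ^ n‖ ≤ K)
    (hspec : ∀ z ∈ spectrum ℂ T, ‖z‖ = 1 → z = 1) :
    Tendsto (fun n : ℕ => ‖T ^ n * (1 - T)‖) atTop (𝓝 0) := by
  exact KT.main T hpb hspec
end

section
/- Let T be a bounded linear operator on a complex Banach space satisfying the Ritt resolvent condition ‖(zI − T)⁻¹‖ ≤ C/|z − 1| for all |z| > 1. Then there exists a constant C′ such that ‖T^n (I − T)‖ ≤ C′/(n+1) for all n ≥ 0. -/
open Filter Topology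

lemma ritt_poisson (r : ℝ) (h0 : 0 < r) (h1 : r < 1) :
    (2 * Real.pi)⁻¹ * ∫ θ in (0:ℝ)..2 * Real.pi, (‖1 - circleMap 0 r θ‖ ^ 2)⁻¹ = (1 - r ^ 2)⁻¹ := by
  have hne : ∀ z : ℂ, ‖z‖ ≤ r → 1 - z ≠ 0 := by
    intro z hz h
    have : z = 1 := (sub_eq_zero.1 h).symm
    subst this
    simp at hz
    linarith
  have hd : DiffContOnCl ℂ (fun z : ℂ => (1 + z) / (1 - z)) (Metric.ball 0 |r|) := by
    rw [abs_of_pos h0]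
    apply DifferentiableOn.diffContOnCl
    rw [closure_ball _ h0.ne']
    intro z hz
    have hz' : ‖z‖ ≤ r := by simpa using hz
    apply DifferentiableAt.differentiableWithinAt
    exact DifferentiableAt.div (by fun_prop) (by fun_prop) (hne z hz')
  have hav := hd.circleAverage
  rw [Real.circleAverage_def] at hav
  have hcont : Continuous (fun θ : ℝ => (1 + circleMap 0 r θ) / (1 - circleMap 0 r θ)) := by
    apply Continuous.div (by fun_prop) (by fun_prop)
    intro θ
    exact hne _ (by simp [abs_of_pos h0])
  have hre := Complex.reCLM.intervalIntegral_comp_comm (hcont.intervalIntegrable (μ := MeasureTheory.volume) 0 (2 * Real.pi))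
  have h2 := congrArg Complex.re hav
  simp only [Complex.smul_re, add_zero, sub_zero, div_one, Complex.one_re, smul_eq_mul] at h2
  simp only [Complex.reCLM_apply] at hre
  rw [← hre] at h2
  have hpt : ∀ θ : ℝ, ((1 + circleMap 0 r θ) / (1 - circleMap 0 r θ)).re
      = (1 - r ^ 2) * (‖1 - circleMap 0 r θ‖ ^ 2)⁻¹ := by
    intro θ
    have hn : ‖circleMap 0 r θ‖ = r := by simp [abs_of_pos h0]
    generalize circleMap 0 r θ = z at hn
    rw [← hn, Complex.div_re, ← Complex.normSq_eq_norm_sq, ← Complex.normSq_eq_norm_sq,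
      ← add_div, div_eq_mul_inv]
    congr 1
    simp [Complex.normSq_apply]
    ring
  simp only [hpt, intervalIntegral.integral_const_mul] at h2
  have : 0 < 1 - r ^ 2 := by nlinarith
  field_simp at h2 ⊢
  linarith

lemma ritt_coeff {A : Type*} [NormedRing A] [NormedAlgebra ℂ A] [CompleteSpace A] (T : A)
    (hspr : spectralRadius ℂ T ≤ 1) (r : ℝ) (h0 : 0 < r) (h1 : r < 1) (n : ℕ) :
    ((n + 2).choose 2 : ℝ) * ‖T ^ n * (1 - T)‖ ≤
      ((2 * Real.pi)⁻¹ * ∫ θ in (0:ℝ)..2 * Real.pi,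
        ‖Ring.inverse (1 - circleMap 0 r θ • T) ^ 3 * (1 - T)‖) * r⁻¹ ^ n := by
  set f : ℂ → A := fun z => Ring.inverse (1 - z • T) ^ 3 * (1 - T) with hf
  lift r to NNReal using h0.le
  have h0' : 0 < r := by exact_mod_cast h0
  have hr : (r : ENNReal) < (spectralRadius ℂ T)⁻¹ := by
    refine lt_of_lt_of_le (b := 1) (by exact_mod_cast h1) ?_
    exact ENNReal.one_le_inv.2 hspr
  have hd : DifferentiableOn ℂ f (Metric.closedBall 0 r) :=
    ((spectrum.differentiableOn_inverse_one_sub_smul hr).pow 3).mul_const _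
  have hs := (hd.hasFPowerSeriesOnBall h0').hasFPowerSeriesAt
  have hs2 : HasFPowerSeriesAt f (fun n => ContinuousMultilinearMap.mkPiRing ℂ (Fin n)
      (((n + 2).choose 2 : ℂ) • (T ^ n * (1 - T)))) 0 := by
    refine hasFPowerSeriesAt_iff.2 ?_
    have hev : ∀ᶠ z : ℂ in 𝓝 0, ‖z • T‖ < 1 := by
      have : Continuous (fun z : ℂ => ‖z • T‖) := by fun_prop
      exact this.continuousAt.eventually_lt continuousAt_const (by simp)
    filter_upwards [hev] with z hz
    have := (hasSum_choose_mul_geometric_of_norm_lt_one' 2 hz).mul_right (1 - T)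
    simp only [hf, zero_add]
    refine Eq.mp (congrArg (fun g => HasSum g _) (funext fun k => ?_)) this
    have hco : FormalMultilinearSeries.coeff (fun n => ContinuousMultilinearMap.mkPiRing ℂ (Fin n)
      (((n + 2).choose 2 : ℂ) • (T ^ n * (1 - T)))) k =
        ((k + 2).choose 2 : ℂ) • (T ^ k * (1 - T)) := by
      simp [FormalMultilinearSeries.coeff]
    rw [hco, smul_pow, mul_assoc, smul_mul_assoc, mul_smul_comm, ← nsmul_eq_mul,
      Nat.cast_smul_eq_nsmul]
  have he := congrFun (hs2.eq_formalMultilinearSeries hs) n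
  have hb := norm_cauchyPowerSeries_le f 0 r n
  rw [← he, ContinuousMultilinearMap.norm_mkPiRing, norm_smul, abs_of_pos h0] at hb
  simpa using hb

lemma ritt_pt {X : Type*} [NormedAddCommGroup X] [NormedSpace ℂ X] [CompleteSpace X]
    (T : X →L[ℂ] X) (C : ℝ) (hC : 0 < C)
    (hritt : ∀ z : ℂ, 1 < ‖z‖ → z ∈ resolventSet ℂ T ∧
      ‖Ring.inverse (algebraMap ℂ (X →L[ℂ] X) z - T)‖ ≤ C / ‖z - 1‖)
    (w : ℂ) (h0 : 0 < ‖w‖) (h1 : ‖w‖ < 1) :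
    ‖Ring.inverse (1 - w • T) ^ 3 * (1 - T)‖ ≤ C ^ 2 * (C + 1) * ‖w‖⁻¹ * (‖1 - w‖ ^ 2)⁻¹ := by
  have hw : w ≠ 0 := norm_pos_iff.1 h0
  obtain ⟨hu, hn⟩ := hritt w⁻¹ (by rw [norm_inv]; exact (one_lt_inv₀ h0).2 h1)
  rw [spectrum.mem_resolventSet_iff] at hu
  set S := algebraMap ℂ (X →L[ℂ] X) w⁻¹ - T with hS
  have hST : 1 - w • T = w • S := by
    rw [hS, smul_sub, Algebra.algebraMap_eq_smul_one, smul_smul, mul_inv_cancel₀ hw, one_smul]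
  have hinv : Ring.inverse (1 - w • T) = w⁻¹ • Ring.inverse S := by
    rw [hST]
    have e1 : (w • S) * (w⁻¹ • Ring.inverse S) = 1 := by
      rw [smul_mul_smul_comm, mul_inv_cancel₀ hw, Ring.mul_inverse_cancel _ hu, one_smul]
    have e2 : (w⁻¹ • Ring.inverse S) * (w • S) = 1 := by
      rw [smul_mul_smul_comm, inv_mul_cancel₀ hw, Ring.inverse_mul_cancel _ hu, one_smul]
    exact Ring.inverse_unit ⟨w • S, w⁻¹ • Ring.inverse S, e1, e2⟩
  have hd : 0 < ‖1 - w‖ := by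
    rw [norm_pos_iff, sub_ne_zero]
    rintro rfl
    simp at h1
  have hnb : ‖Ring.inverse (1 - w • T)‖ ≤ C / ‖1 - w‖ := by
    rw [hinv, norm_smul]
    have : w⁻¹ - 1 = w⁻¹ * (1 - w) := by field_simp
    rw [this, norm_mul] at hn
    calc ‖w⁻¹‖ * ‖Ring.inverse S‖ ≤ ‖w⁻¹‖ * (C / (‖w⁻¹‖ * ‖1 - w‖)) := by gcongr
      _ = _ := by rw [norm_inv]; field_simp
  have hunit : Ring.inverse (1 - w • T) * (1 - w • T) = 1 := by
    rw [hinv, hST, smul_mul_smul_comm, inv_mul_cancel₀ hw, Ring.inverse_mul_cancel _ hu, one_smul]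
  set R := Ring.inverse (1 - w • T) with hR
  have hq : R * (1 - T) = w⁻¹ • (1 - (1 - w) • R) := by
    have : (1 - T) = w⁻¹ • ((1 - w • T) - (1 - w) • 1) := by
      rw [sub_smul, one_smul]
      have : (1 - w • T - (1 - w • (1 : X →L[ℂ] X))) = w • (1 - T) := by
        rw [smul_sub]; abel
      rw [this, smul_smul, inv_mul_cancel₀ hw, one_smul]
    rw [this, mul_smul_comm, mul_sub, hunit, mul_smul_comm, mul_one]
  have hone : ‖(1 : X →L[ℂ] X)‖ ≤ 1 := ContinuousLinearMap.norm_id_le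
  have hqb : ‖R * (1 - T)‖ ≤ ‖w‖⁻¹ * (C + 1) := by
    rw [hq, norm_smul, norm_inv]
    gcongr
    calc _ ≤ ‖(1 : X →L[ℂ] X)‖ + ‖(1 - w) • R‖ := norm_sub_le _ _
      _ ≤ 1 + ‖1 - w‖ * (C / ‖1 - w‖) := by rw [norm_smul]; gcongr
      _ = C + 1 := by field_simp; ring
  calc ‖R ^ 3 * (1 - T)‖ = ‖R * (R * (R * (1 - T)))‖ := by rw [pow_succ, pow_two, mul_assoc, mul_assoc]
    _ ≤ ‖R‖ * (‖R‖ * ‖R * (1 - T)‖) :=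
      (norm_mul_le _ _).trans (by gcongr; exact norm_mul_le _ _)
    _ ≤ (C / ‖1 - w‖) * ((C / ‖1 - w‖) * (‖w‖⁻¹ * (C + 1))) := by gcongr
    _ = _ := by field_simp

/-- A Ritt operator satisfies `‖T^n (I - T)‖ = O(1/n)`. -/
theorem stmt2 {X : Type*} [NormedAddCommGroup X] [NormedSpace ℂ X] [CompleteSpace X]
    (T : X →L[ℂ] X) (hspr : spectralRadius ℂ T ≤ 1) (C : ℝ) (hC : 0 < C)
    (hritt : ∀ z : ℂ, 1 < ‖z‖ → z ∈ resolventSet ℂ T ∧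
      ‖Ring.inverse (algebraMap ℂ (X →L[ℂ] X) z - T)‖ ≤ C / ‖z - 1‖) :
    ∃ C' : ℝ, ∀ n : ℕ, ‖T ^ n * (1 - T)‖ ≤ C' / (n + 1) := by
  refine ⟨2 * Real.exp 1 * (C ^ 2 * (C + 1)), fun n => ?_⟩
  set r : ℝ := (n + 1) / (n + 2) with hr
  have h0 : 0 < r := by positivity
  have h1 : r < 1 := by rw [hr, div_lt_one (by positivity)]; linarith
  have hc := ritt_coeff T hspr r h0 h1 n
  set K := C ^ 2 * (C + 1) with hK
  have hKpos : 0 < K := by positivity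
  have hint : ∫ θ in (0:ℝ)..2 * Real.pi, ‖Ring.inverse (1 - circleMap 0 r θ • T) ^ 3 * (1 - T)‖
      ≤ ∫ θ in (0:ℝ)..2 * Real.pi, (K * r⁻¹) * (‖1 - circleMap 0 r θ‖ ^ 2)⁻¹ := by
    have hn : ∀ θ, ‖circleMap 0 r θ‖ = r := fun θ => by simp [abs_of_pos h0]
    have hne : ∀ θ, 1 - circleMap 0 r θ ≠ 0 := by
      intro θ h
      have := hn θ
      rw [← sub_eq_zero.1 h] at this
      simp at this
      linarith
    have hcont : Continuous (fun θ : ℝ => (K * r⁻¹) * (‖1 - circleMap 0 r θ‖ ^ 2)⁻¹) := by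
      refine continuous_const.mul (Continuous.inv₀ (by fun_prop) fun θ => ?_)
      exact pow_ne_zero 2 (norm_ne_zero_iff.2 (hne θ))
    have hpi : (0:ℝ) ≤ 2 * Real.pi := by positivity
    rw [intervalIntegral.integral_of_le hpi, intervalIntegral.integral_of_le hpi]
    apply MeasureTheory.integral_mono_of_nonneg
    · exact Eventually.of_forall fun θ => norm_nonneg _
    · exact (hcont.intervalIntegrable (μ := MeasureTheory.volume) 0 (2 * Real.pi)).1
    · refine Eventually.of_forall fun θ => ?_
      have := ritt_pt T C hC hritt (circleMap 0 r θ) (by rw [hn]; exact h0) (by rw [hn]; exact h1)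
      rwa [hn] at this
  rw [intervalIntegral.integral_const_mul] at hint
  have hp := ritt_poisson r h0 h1
  have hmain : ((n + 2).choose 2 : ℝ) * ‖T ^ n * (1 - T)‖ ≤ K * r⁻¹ ^ (n + 1) * (1 - r ^ 2)⁻¹ := by
    refine hc.trans ?_
    calc _ ≤ ((2 * Real.pi)⁻¹ * (K * r⁻¹ * ∫ θ in (0:ℝ)..2 * Real.pi, (‖1 - circleMap 0 r θ‖ ^ 2)⁻¹)) * r⁻¹ ^ n := by
          gcongr
      _ = K * r⁻¹ ^ (n + 1) * ((2 * Real.pi)⁻¹ * ∫ θ in (0:ℝ)..2 * Real.pi, (‖1 - circleMap 0 r θ‖ ^ 2)⁻¹) := by ring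
      _ = _ := by rw [hp]
  have hexp : r⁻¹ ^ (n + 1) ≤ Real.exp 1 := by
    have : r⁻¹ ≤ Real.exp (1 / (n + 1)) := by
      refine le_trans (le_of_eq ?_) (Real.add_one_le_exp _)
      rw [hr]; field_simp; ring
    calc r⁻¹ ^ (n + 1) ≤ Real.exp (1 / (n + 1)) ^ (n + 1) := by gcongr
      _ = Real.exp 1 := by
        rw [← Real.exp_nat_mul]; congr 1; push_cast; field_simp
  have hinv : (1 - r ^ 2)⁻¹ ≤ (n : ℝ) + 2 := by
    apply inv_le_of_inv_le₀ (by positivity)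
    have : ((n : ℝ) + 2)⁻¹ = 1 - r := by rw [hr]; field_simp; ring
    rw [this]
    nlinarith
  have hch : ((n + 2).choose 2 : ℝ) = (n + 2) * (n + 1) / 2 := by
    rw [Nat.cast_choose_two]; push_cast; ring
  have hpos : 0 ≤ (1 - r ^ 2)⁻¹ := inv_nonneg.2 (by nlinarith)
  have hfin : ((n : ℝ) + 2) * (n + 1) / 2 * ‖T ^ n * (1 - T)‖ ≤ K * Real.exp 1 * (n + 2) := by
    rw [← hch]
    refine hmain.trans ?_
    gcongr
  rw [le_div_iff₀ (by positivity)]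
  have h2 : (0:ℝ) < n + 2 := by positivity
  refine le_of_mul_le_mul_left ?_ h2
  linarith
end

section
/- Let T be a bounded linear operator on a complex Banach space with σ(T) = {1} and T ≠ I. Then limsup_{n→∞} n‖T^n(I − T)‖ > 0; in fact liminf_{n→∞} n‖T^n(I − T)‖ ≥ 1/96. -/
open Filter Topology

lemma aux_pow_sub {B : Type*} [NormedCommRing B] [NormOneClass B] (a b : B) (M : ℝ) (hM : 1 ≤ M)
    (ha : ‖a‖ ≤ M) (hb : ‖b‖ ≤ M) (n : ℕ) : ‖a ^ n - b ^ n‖ ≤ n * M ^ n * ‖a - b‖ := by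
  induction n with
  | zero => simp
  | succ n ih =>
    have e : a ^ (n + 1) - b ^ (n + 1) = a * (a ^ n - b ^ n) + (a - b) * b ^ n := by ring
    have h1 : ‖a * (a ^ n - b ^ n)‖ ≤ M * (n * M ^ n * ‖a - b‖) :=
      (norm_mul_le _ _).trans (mul_le_mul ha ih (norm_nonneg _) (by linarith))
    have hbn : ‖b ^ n‖ ≤ M ^ n :=
      (norm_pow_le b n).trans (pow_le_pow_left₀ (norm_nonneg _) hb n)
    have hMn : M ^ n ≤ M ^ (n + 1) := pow_le_pow_right₀ hM (Nat.le_succ n)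
    have h2 : ‖(a - b) * b ^ n‖ ≤ ‖a - b‖ * M ^ (n + 1) :=
      (norm_mul_le _ _).trans (mul_le_mul_of_nonneg_left (hbn.trans hMn) (norm_nonneg _))
    rw [e]
    refine (norm_add_le _ _).trans ((add_le_add h1 h2).trans (le_of_eq ?_))
    push_cast
    ring

lemma aux_main {B : Type*} [NormedCommRing B] [NormedAlgebra ℂ B] [CompleteSpace B]
    [NormOneClass B] (q : B) (hq : spectrum ℂ q ⊆ {0}) (n : ℕ) (hn : 0 < n)
    (hW : (n : ℝ) * ‖q * (1 + q) ^ n‖ ≤ 1 / 96) : (n : ℝ) * ‖q‖ ≤ 1 / 8 := by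
  have hn' : (0 : ℝ) < n := by exact_mod_cast hn
  have hn1 : (1 : ℝ) ≤ n := by exact_mod_cast hn
  set W := q * (1 + q) ^ n with hWdef
  set r : ℝ := 1 / (8 * n) with hr
  have hr0 : 0 < r := by positivity
  have hrn : n * r = 1 / 8 := by rw [hr]; field_simp
  set M : ℝ := 1 + r with hM
  have hM1 : 1 ≤ M := by linarith
  have hMn : M ^ n ≤ 8 / 7 := by
    have h1 : M ≤ Real.exp r := by have := Real.add_one_le_exp r; linarith
    have h2 : M ^ n ≤ Real.exp (1 / 8) := by
      rw [← hrn, Real.exp_nat_mul]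
      exact pow_le_pow_left₀ (by linarith) h1 n
    have h3 := Real.add_one_le_exp (-(1 / 8 : ℝ))
    have h4 : Real.exp (1 / 8) * Real.exp (-(1 / 8)) = 1 := by rw [← Real.exp_add]; simp
    have h5 := Real.exp_pos (1 / 8)
    nlinarith
  have hball : ∀ U : B, ‖U‖ ≤ r → ‖1 + U‖ ≤ M := fun U hU =>
    (norm_add_le _ _).trans (by rw [norm_one]; linarith)
  have hdiff : ∀ U V : B, ‖U‖ ≤ r → ‖V‖ ≤ r →
      ‖(1 + U) ^ n - (1 + V) ^ n‖ ≤ n * (8 / 7) * ‖U - V‖ := by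
    intro U V hU hV
    have := aux_pow_sub (1 + U) (1 + V) M hM1 (hball U hU) (hball V hV) n
    rw [add_sub_add_left_eq_sub] at this
    refine this.trans ?_
    gcongr
  have hsmall : ∀ U : B, ‖U‖ ≤ r → ‖(1 + U) ^ n - 1‖ ≤ 1 / 7 := by
    intro U hU
    have := hdiff U 0 hU (by simpa using hr0.le)
    simp only [add_zero, one_pow, sub_zero] at this
    nlinarith
  let f : B → B := fun U => W - U * ((1 + U) ^ n - 1)
  have hWr : ‖W‖ ≤ r / 12 := by
    have : n * ‖W‖ ≤ n * (r / 12) := by linarith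
    exact le_of_mul_le_mul_left this hn'
  have hmaps : Set.MapsTo f (Metric.closedBall 0 r) (Metric.closedBall 0 r) := by
    intro U hU
    rw [mem_closedBall_zero_iff] at hU ⊢
    have h1 : ‖U * ((1 + U) ^ n - 1)‖ ≤ r * (1 / 7) :=
      (norm_mul_le _ _).trans (mul_le_mul hU (hsmall U hU) (norm_nonneg _) hr0.le)
    refine (norm_sub_le _ _).trans ?_
    linarith
  have hcontr : ContractingWith (1 / 2) (hmaps.restrict f _ _) := by
    refine ⟨by norm_num, LipschitzWith.of_dist_le_mul ?_⟩
    rintro ⟨U, hU⟩ ⟨V, hV⟩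
    rw [mem_closedBall_zero_iff] at hU hV
    change dist (f U) (f V) ≤ _ * dist U V
    rw [dist_eq_norm, dist_eq_norm]
    have e : f U - f V = -((U - V) * ((1 + U) ^ n - 1) + V * ((1 + U) ^ n - (1 + V) ^ n)) := by
      simp only [f]; ring
    have h1 : ‖(U - V) * ((1 + U) ^ n - 1)‖ ≤ ‖U - V‖ * (1 / 7) :=
      (norm_mul_le _ _).trans (mul_le_mul_of_nonneg_left (hsmall U hU) (norm_nonneg _))
    have h2 : ‖V * ((1 + U) ^ n - (1 + V) ^ n)‖ ≤ r * (n * (8 / 7) * ‖U - V‖) :=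
      (norm_mul_le _ _).trans (mul_le_mul hV (hdiff U V hU hV) (norm_nonneg _) hr0.le)
    have h3 : r * (n * (8 / 7) * ‖U - V‖) = (n * r) * (8 / 7) * ‖U - V‖ := by ring
    rw [h3, hrn] at h2
    rw [e, norm_neg]
    refine (norm_add_le _ _).trans ?_
    have := norm_nonneg (U - V)
    have hk : (((1 / 2 : NNReal)) : ℝ) = 1 / 2 := by norm_num
    rw [hk]
    linarith
  obtain ⟨U, hU, hfix, -⟩ := hcontr.exists_fixedPoint'
    Metric.isClosed_closedBall.isComplete hmaps (x := 0)
    (Metric.mem_closedBall_self hr0.le) (edist_ne_top _ _)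
  rw [mem_closedBall_zero_iff] at hU
  have hfix' : W - U * ((1 + U) ^ n - 1) = U := hfix
  have hUW : U * (1 + U) ^ n = q * (1 + q) ^ n := by
    rw [← hWdef]; linear_combination -hfix'
  have hφq : ∀ φ : WeakDual.characterSpace ℂ B, φ q = 0 := fun φ =>
    hq (AlgHom.apply_mem_spectrum φ q)
  have hφU : ∀ φ : WeakDual.characterSpace ℂ B, φ U = 0 := by
    intro φ
    have h1 := congrArg φ hUW
    simp only [map_mul, map_pow, map_add, map_one, hφq, zero_mul, mul_eq_zero] at h1
    rcases h1 with h1 | h1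
    · exact h1
    · exfalso
      have h2 : 1 + φ U = 0 := by
        by_contra h
        exact pow_ne_zero n h h1
      have h3 : ‖φ U‖ ≤ ‖U‖ := spectrum.norm_le_norm_of_mem (AlgHom.apply_mem_spectrum φ U)
      have h4 : φ U = -1 := by linear_combination h2
      rw [h4] at h3
      simp only [norm_neg, norm_one] at h3
      nlinarith
  obtain ⟨c, hc⟩ := sub_dvd_pow_sub_pow (1 + U) (1 + q) n
  have hunit : IsUnit ((1 + U) ^ n + q * c) := by
    by_contra h
    obtain ⟨φ, hφ⟩ := WeakDual.CharacterSpace.exists_apply_eq_zero h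
    simp [hφq, hφU] at hφ
  have hz : (U - q) * ((1 + U) ^ n + q * c) = 0 := by
    linear_combination hUW - q * hc
  have hUq : U - q = 0 := (hunit.mul_left_eq_zero).1 hz
  rw [sub_eq_zero] at hUq
  rw [← hUq]
  nlinarith

lemma aux_alg {A : Type*} [NormedRing A] [NormedAlgebra ℂ A] [CompleteSpace A] [NormOneClass A]
    (T : A) (hspec : spectrum ℂ T = {1}) (n : ℕ) (hn : 0 < n)
    (hW : (n : ℝ) * ‖T ^ n * (1 - T)‖ ≤ 1 / 96) : (n : ℝ) * ‖T - 1‖ ≤ 1 / 8 := by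
  let S := Algebra.elemental ℂ T
  let _ : NormedCommRing S := { (inferInstance : NormedRing S) with mul_comm := mul_comm }
  have _ : NormOneClass S := ⟨norm_one (α := A)⟩
  have _ : IsClosed (S : Set A) := Algebra.elemental.isClosed ℂ T
  let t : S := ⟨T, Algebra.elemental.self_mem ℂ T⟩
  have hpre : IsPreconnected (spectrum ℂ (t : A))ᶜ := by
    change IsPreconnected (spectrum ℂ T)ᶜ
    rw [hspec]
    exact (isConnected_compl_singleton_of_one_lt_rank (by simp) 1).isPreconnected
  have hst : spectrum ℂ t = {1} := by
    rw [Subalgebra.spectrum_eq_of_isPreconnected_compl S t hpre]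
    exact hspec
  have hq : spectrum ℂ (t - 1) ⊆ {0} := by
    have := spectrum.sub_singleton_eq t (1 : ℂ)
    rw [map_one] at this
    rw [← this, hst]
    simp
  have e : (t - 1) * (1 + (t - 1)) ^ n = -(t ^ n * (1 - t)) := by
    rw [add_sub_cancel]; ring
  have hW' : (n : ℝ) * ‖(t - 1) * (1 + (t - 1)) ^ n‖ ≤ 1 / 96 := by
    rw [e, norm_neg]
    exact hW
  exact aux_main (t - 1) hq n hn hW'

lemma aux_op {X : Type*} [NormedAddCommGroup X] [NormedSpace ℂ X] [CompleteSpace X]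
    (T : X →L[ℂ] X) (hspec : spectrum ℂ T = {1}) (hT : T ≠ 1) (n : ℕ) (hn : 0 < n)
    (hW : (n : ℝ) * ‖T ^ n * (1 - T)‖ ≤ 1 / 96) : (n : ℝ) * ‖T - 1‖ ≤ 1 / 8 := by
  have hX : Nontrivial X := by
    by_contra h
    rw [not_nontrivial_iff_subsingleton] at h
    exact hT (ContinuousLinearMap.ext fun x => Subsingleton.elim _ _)
  exact aux_alg T hspec n hn hW

/-- Esterle's lower bound: if `σ(T) = {1}` and `T ≠ I`, then
`liminf n ‖T^n (I - T)‖ ≥ 1/96`. -/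
theorem stmt5 {X : Type*} [NormedAddCommGroup X] [NormedSpace ℂ X] [CompleteSpace X]
    (T : X →L[ℂ] X) (hspec : spectrum ℂ T = {1}) (hT : T ≠ 1) :
    (1 / 96 : ENNReal) ≤
      atTop.liminf (fun n : ℕ => ENNReal.ofReal ((n : ℝ) * ‖T ^ n * (1 - T)‖)) := by
  refine le_liminf_of_le (by isBoundedDefault) ?_
  have hpos : 0 < ‖T - 1‖ := norm_pos_iff.2 (sub_ne_zero.2 hT)
  obtain ⟨N, hN⟩ := exists_nat_gt (1 / 8 / ‖T - 1‖)
  filter_upwards [eventually_ge_atTop (max N 1)] with n hn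
  have hn1 : 0 < n := lt_of_lt_of_le one_pos ((le_max_right _ _).trans hn)
  have hnN : (N : ℝ) ≤ n := by exact_mod_cast (le_max_left _ _).trans hn
  have key : (1 / 96 : ℝ) ≤ n * ‖T ^ n * (1 - T)‖ := by
    by_contra h
    push Not at h
    have h1 := aux_op T hspec hT n hn1 h.le
    rw [div_lt_iff₀ hpos] at hN
    nlinarith
  have h96 : (1 / 96 : ENNReal) = ENNReal.ofReal (1 / 96) := by
    rw [ENNReal.ofReal_div_of_pos (by norm_num)]; norm_num
  rw [h96]
  exact ENNReal.ofReal_le_ofReal key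
end

section
/- Let T be a power-bounded, mean-ergodic operator on a complex Banach space X with σ(T) ∩ 𝕋 ⊆ {1}. Then T^n converges in the strong operator topology to the projection P of X onto Ker(I − T) along the closure of Ran(I − T): for every x ∈ X, ‖T^n x − P x‖ → 0. -/
open Filter Topology

/-- Liouville-type lemma. -/
lemma kt_liouville (g : ℂ → ℂ) (hg : Differentiable ℂ g) (C : ℝ) (hC : 0 ≤ C)
    (hb : ∀ v : ℂ, v.re ≠ 0 → ‖g v‖ * (2 * |v.re|) ≤ C * (2 * ‖v‖ + 1)) (a b : ℂ) :
    g a = g b := by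
  have key : ∀ v : ℂ, ‖g v‖ ≤ 4 * C := by
    intro v
    set R : ℝ := 2 * ‖v‖ + 1 with hR
    have hv0 := norm_nonneg v
    have hR1 : 1 ≤ R := by linarith
    have h1 : ‖(v ^ 2 + (R : ℂ) ^ 2) * g v‖ ≤ R * (C * (2 * R + 1)) := by
      have hd : DiffContOnCl ℂ (fun v : ℂ => (v ^ 2 + (R : ℂ) ^ 2) * g v) (Metric.ball 0 R) := by
        apply Differentiable.diffContOnCl
        fun_prop
      refine Complex.norm_le_of_forall_mem_frontier_norm_le Metric.isBounded_ball hd ?_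
        (subset_closure (by simp [hR]; linarith))
      intro z hz
      rw [frontier_ball _ (by linarith)] at hz
      have hz' : ‖z‖ = R := by simpa using hz
      have e : z ^ 2 + (R : ℂ) ^ 2 = z * (2 * z.re : ℝ) := by
        have : (R : ℂ) ^ 2 = z * (starRingEnd ℂ) z := by
          rw [Complex.mul_conj, Complex.normSq_eq_norm_sq, hz']; push_cast; ring
        rw [this, ← Complex.add_conj]; ring
      rw [e, norm_mul, norm_mul, hz', Complex.norm_real, Real.norm_eq_abs, abs_mul, abs_two,
        mul_assoc]
      apply mul_le_mul_of_nonneg_left _ (by linarith)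
      by_cases h0 : z.re = 0
      · simp [h0]; positivity
      · have := hb z h0
        rw [hz'] at this; linarith
    have h2 : R ^ 2 * (3 / 4) ≤ ‖v ^ 2 + (R : ℂ) ^ 2‖ := by
      have : ‖(R : ℂ) ^ 2‖ - ‖v ^ 2‖ ≤ ‖v ^ 2 + (R : ℂ) ^ 2‖ := by
        have := norm_sub_le (v ^ 2 + (R : ℂ) ^ 2) (v ^ 2)
        rw [add_sub_cancel_left] at this; linarith
      rw [norm_pow, norm_pow, Complex.norm_real, Real.norm_eq_abs, sq_abs] at this
      nlinarith
    rw [norm_mul] at h1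
    have h3 : R ^ 2 * (3 / 4) * ‖g v‖ ≤ R * (C * (2 * R + 1)) :=
      (mul_le_mul_of_nonneg_right h2 (norm_nonneg _)).trans h1
    have h4 : R * (C * (2 * R + 1)) ≤ R ^ 2 * (3 / 4) * (4 * C) := by
      have : 0 ≤ R * C * (R - 1) := by
        apply mul_nonneg (by positivity); linarith
      nlinarith
    exact le_of_mul_le_mul_left (h3.trans h4) (by positivity)
  apply hg.apply_eq_apply_of_bounded
  rw [isBounded_iff_forall_norm_le]
  exact ⟨4 * C, by rintro _ ⟨v, rfl⟩; exact key v⟩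

/-- spectrum lies in the closed unit disc -/
lemma kt_spec {X : Type*} [NormedAddCommGroup X] [NormedSpace ℂ X] [CompleteSpace X]
    (T : X →L[ℂ] X) (K : ℝ) (hpb : ∀ n : ℕ, ‖T ^ n‖ ≤ K) (z : ℂ) (hz : z ∈ spectrum ℂ T) :
    ‖z‖ ≤ 1 := by
  by_contra! h
  have hbd : ∀ n : ℕ, ‖z‖ ^ n ≤ K * ‖(1 : X →L[ℂ] X)‖ := by
    intro n
    have h1 := spectrum.norm_le_norm_mul_of_mem (spectrum.pow_mem_pow T n hz)
    rw [norm_pow] at h1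
    exact h1.trans (mul_le_mul_of_nonneg_right (hpb n) (norm_nonneg _))
  obtain ⟨n, hn⟩ := pow_unbounded_of_one_lt (K * ‖(1 : X →L[ℂ] X)‖) h
  exact absurd (hbd n) (not_le.mpr hn)

lemma kt_unit {X : Type*} [NormedAddCommGroup X] [NormedSpace ℂ X] [CompleteSpace X]
    (T : X →L[ℂ] X) (K : ℝ) (hpb : ∀ n : ℕ, ‖T ^ n‖ ≤ K)
    (hspec : ∀ z ∈ spectrum ℂ T, ‖z‖ = 1 → z = 1) (w : ℂ) (hw : ‖w - 1‖ ≤ ‖w‖) :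
    IsUnit (w • (1 : X →L[ℂ] X) - (w - 1) • T) := by
  by_cases h1 : w = 1
  · simp [h1]
  have h2 : w - 1 ≠ 0 := sub_ne_zero.mpr h1
  have h3 : w / (w - 1) ∉ spectrum ℂ T := by
    intro h
    have h4 := kt_spec T K hpb _ h
    have h5 : ‖w / (w - 1)‖ = 1 := by
      apply le_antisymm h4
      rw [norm_div, le_div_iff₀ (norm_pos_iff.mpr h2)]; linarith
    have h6 := hspec _ h h5
    rw [div_eq_one_iff_eq h2] at h6
    have : (1 : ℂ) = 0 := by linear_combination h6
    exact one_ne_zero this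
  rw [spectrum.notMem_iff] at h3
  have e : w • (1 : X →L[ℂ] X) - (w - 1) • T
      = (w - 1) • (algebraMap ℂ (X →L[ℂ] X) (w / (w - 1)) - T) := by
    rw [Algebra.algebraMap_eq_smul_one, smul_sub, smul_smul, mul_div_cancel₀ _ h2]
  rw [e]
  exact h3.smul (Units.mk0 _ h2)

lemma kt_res {X : Type*} [NormedAddCommGroup X] [NormedSpace ℂ X]
    (T : X →L[ℂ] X) (K : ℝ) (hpb : ∀ n : ℕ, ‖T ^ n‖ ≤ K) (w : ℂ)
    (x y : X) (hxy : w • x - (w - 1) • T x = y) (hw : ‖w - 1‖ ≤ ‖w‖) :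
    ‖x‖ * (‖w‖ - ‖w - 1‖) ≤ K * ‖y‖ := by
  have hle : ∀ n (u : X), ‖(T ^ n) u‖ ≤ K * ‖u‖ := fun n u =>
    (T ^ n).le_of_opNorm_le (hpb n) u
  have hbdd : BddAbove (Set.range fun n : ℕ => ‖(T ^ n) x‖) :=
    ⟨K * ‖x‖, by rintro _ ⟨n, rfl⟩; exact hle n x⟩
  set S := ⨆ n : ℕ, ‖(T ^ n) x‖ with hS
  have hS1 : ∀ n, ‖(T ^ n) x‖ ≤ S := fun n => le_ciSup hbdd n
  have h0 : ‖x‖ ≤ S := by simpa using hS1 0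
  have h1 : ∀ n : ℕ, ‖w‖ * ‖(T ^ n) x‖ ≤ K * ‖y‖ + ‖w - 1‖ * S := by
    intro n
    have e : w • (T ^ n) x = (T ^ n) y + (w - 1) • (T ^ (n + 1)) x := by
      rw [← hxy, pow_succ, map_sub, map_smul, map_smul]
      change _ = _ - _ + (w - 1) • (T ^ n) (T x)
      rw [sub_add_cancel]
    rw [← norm_smul, e]
    refine (norm_add_le _ _).trans (add_le_add (hle n y) ?_)
    rw [norm_smul]
    exact mul_le_mul_of_nonneg_left (hS1 _) (norm_nonneg _)
  have h2 : ‖w‖ * S ≤ K * ‖y‖ + ‖w - 1‖ * S := by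
    rw [hS, Real.mul_iSup_of_nonneg (norm_nonneg _)]
    exact ciSup_le h1
  have := mul_le_mul_of_nonneg_right h0 (sub_nonneg.mpr hw)
  linarith

lemma kt_series (u : ℕ → ℂ) (C : ℝ) (hu : ∀ n, ‖u n‖ ≤ C) :
    (∀ s : ℂ, ‖s‖ < 1 → Summable (fun k => s ^ k * u k)) ∧
    (∀ s : ℂ, ‖s‖ < 1 → ‖∑' k, s ^ k * u k‖ * (1 - ‖s‖) ≤ C) ∧
    (∀ s : ℂ, ‖s‖ < 1 → DifferentiableAt ℂ (fun s : ℂ => ∑' k, s ^ k * u k) s) := by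
  have hle : ∀ (s : ℂ) (r : ℝ), ‖s‖ ≤ r → ∀ k, ‖s ^ k * u k‖ ≤ r ^ k * C := by
    intro s r hr k
    rw [norm_mul, norm_pow]
    have := norm_nonneg s
    exact mul_le_mul (pow_le_pow_left₀ this hr k) (hu k) (norm_nonneg _) (by
      have : 0 ≤ r := by linarith
      positivity)
  refine ⟨?_, ?_, ?_⟩
  · intro s hs
    exact Summable.of_norm_bounded
      ((summable_geometric_of_lt_one (norm_nonneg s) hs).mul_right C) (hle s _ le_rfl)
  · intro s hs
    have := tsum_of_norm_bounded
      ((hasSum_geometric_of_lt_one (norm_nonneg s) hs).mul_right C) (hle s _ le_rfl)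
    rwa [inv_mul_eq_div, le_div_iff₀ (by linarith)] at this
  · intro s hs
    obtain ⟨r, hr1, hr2⟩ := exists_between hs
    have hr0 : 0 ≤ r := (norm_nonneg s).trans hr1.le
    have := Complex.differentiableOn_tsum_of_summable_norm (F := fun k (s : ℂ) => s ^ k * u k)
      (U := Metric.ball 0 r)
      ((summable_geometric_of_lt_one hr0 hr2).mul_right C)
      (fun k => by fun_prop) Metric.isOpen_ball
      (fun k w hw => hle w r (by simpa using (Metric.mem_ball.mp hw).le) k)
    exact this.differentiableAt (Metric.isOpen_ball.mem_nhds (by simpa using hr1))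

lemma kt_norm_sq (w : ℂ) : ‖w‖ ^ 2 - ‖w - 1‖ ^ 2 = 2 * w.re - 1 := by
  rw [← Complex.normSq_eq_norm_sq, ← Complex.normSq_eq_norm_sq, Complex.normSq_apply,
    Complex.normSq_apply]
  simp; ring

lemma kt_core {X : Type*} [NormedAddCommGroup X] [NormedSpace ℂ X] [CompleteSpace X]
    (T : X →L[ℂ] X) (K : ℝ) (hpb : ∀ n : ℕ, ‖T ^ n‖ ≤ K)
    (hspec : ∀ z ∈ spectrum ℂ T, ‖z‖ = 1 → z = 1)
    (p : ℕ → X →L[ℂ] ℂ) (C : ℝ) (hp : ∀ k, ‖p k‖ ≤ C)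
    (hpT : ∀ k x, p (k + 1) (T x) = p k x) (x : X) : p 0 (T x) = p 0 x := by
  have hC : 0 ≤ C := (norm_nonneg _).trans (hp 0)
  have hK : 0 ≤ K := (norm_nonneg _).trans (hpb 0)
  set B : ℂ → X →L[ℂ] X := fun w => w • (1 : X →L[ℂ] X) - (w - 1) • T with hB
  have hBd : Differentiable ℂ B := by
    intro w; simp only [hB]; fun_prop
  have hBu : ∀ w, ‖w - 1‖ ≤ ‖w‖ → IsUnit (B w) := kt_unit T K hpb hspec
  have hBi : ∀ w, IsUnit (B w) → ∀ y, B w (Ring.inverse (B w) y) = y := by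
    intro w hw y
    have := congrArg (fun A : X →L[ℂ] X => A y) (Ring.mul_inverse_cancel _ hw)
    simpa using this
  have hBi' : ∀ w, IsUnit (B w) → ∀ y, Ring.inverse (B w) (B w y) = y := by
    intro w hw y
    have := congrArg (fun A : X →L[ℂ] X => A y) (Ring.inverse_mul_cancel _ hw)
    simpa using this
  have hu : ∀ y k, ‖p (k + 1) y‖ ≤ C * ‖y‖ := fun y k => (p (k+1)).le_of_opNorm_le (hp _) y
  set L : ℂ → X → ℂ := fun w y =>
    (1 - w)⁻¹ * ∑' k, (w / (w - 1)) ^ k * p (k + 1) y with hL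
  have hne : ∀ w : ℂ, ‖w‖ < ‖w - 1‖ → w - 1 ≠ 0 := fun w hw =>
    norm_pos_iff.mp ((norm_nonneg w).trans_lt hw)
  have hs1 : ∀ w : ℂ, ‖w‖ < ‖w - 1‖ → ‖w / (w - 1)‖ < 1 := by
    intro w hw
    rw [norm_div, div_lt_one (norm_pos_iff.mpr (hne w hw))]; exact hw
  have hLB : ∀ w : ℂ, ‖w‖ < ‖w - 1‖ → ∀ x, L w (B w x) = p 0 x := by
    intro w hw x
    have h1 := hne w hw
    have hs := hs1 w hw
    set s := w / (w - 1) with hsdef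
    have hws : w = (w - 1) * s := by rw [hsdef, mul_div_cancel₀ _ h1]
    have e1 : B w x = (1 - w) • (T x - s • x) := by
      have : w • x = ((w - 1) * s) • x := by rw [← hws]
      simp only [hB, sub_apply, smul_apply,
        one_apply_eq_self]
      rw [this]; module
    have hsum := (kt_series (fun k => p k x) (C * ‖x‖)
      (fun k => (p k).le_of_opNorm_le (hp _) x)).1 s hs
    have e2 : ∀ k, s ^ k * p (k + 1) (B w x)
        = (1 - w) * (s ^ k * p k x - s ^ (k + 1) * p (k + 1) x) := by
      intro k
      rw [e1, map_smul, map_sub, hpT, map_smul, smul_eq_mul, smul_eq_mul]; ring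
    have h1' : (1 - w) ≠ 0 := by
      intro h; apply h1; linear_combination -h
    simp only [hL]
    rw [← hsdef]
    simp_rw [e2]
    rw [tsum_mul_left, inv_mul_cancel_left₀ h1', hsum.tsum_sub ((summable_nat_add_iff 1).mpr hsum),
      hsum.tsum_eq_zero_add]
    simp
  have main : ∀ y : X, ∃ g : ℂ → ℂ, (∀ w, ‖w - 1‖ ≤ ‖w‖ → g w = p 0 (Ring.inverse (B w) y)) ∧
      ∀ a b, g a = g b := by
    intro y
    classical
    set g : ℂ → ℂ := fun w => if ‖w‖ < ‖w - 1‖ then L w y else p 0 (Ring.inverse (B w) y) with hg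
    have hg1 : ∀ w, ‖w‖ < ‖w - 1‖ → g w = L w y := fun w hw => by simp only [hg]; rw [if_pos hw]
    have hg2 : ∀ w, IsUnit (B w) → g w = p 0 (Ring.inverse (B w) y) := by
      intro w hw
      by_cases h : ‖w‖ < ‖w - 1‖
      · rw [hg1 w h]
        conv_lhs => rw [← hBi w hw y]
        exact hLB w h _
      · simp only [hg]; rw [if_neg h]
    refine ⟨g, fun w hw => hg2 w (hBu w hw), ?_⟩
    have hgd : Differentiable ℂ g := by
      intro w
      by_cases h : ‖w‖ < ‖w - 1‖
      · have ho : IsOpen {w : ℂ | ‖w‖ < ‖w - 1‖} := isOpen_lt (by fun_prop) (by fun_prop)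
        have he : g =ᶠ[𝓝 w] fun w => L w y := by
          filter_upwards [ho.mem_nhds h] with w' hw' using hg1 w' hw'
        refine DifferentiableAt.congr_of_eventuallyEq ?_ he
        have h1 := hne w h
        have h1' : (1 - w) ≠ 0 := by
          intro h; apply h1; linear_combination -h
        simp only [hL]
        refine DifferentiableAt.mul (DifferentiableAt.inv (by fun_prop) h1') ?_
        exact DifferentiableAt.comp (g := fun s : ℂ => ∑' k, s ^ k * p (k + 1) y)
          (f := fun w : ℂ => w / (w - 1)) w
          ((kt_series (fun k => p (k + 1) y) (C * ‖y‖) (hu y)).2.2 _ (hs1 w h))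
          (DifferentiableAt.div (by fun_prop) (by fun_prop) h1)
      · have hw := hBu w (not_lt.mp h)
        have ho : ∀ᶠ w' in 𝓝 w, IsUnit (B w') :=
          hBd.continuous.continuousAt.eventually (Units.isOpen.mem_nhds hw)
        have he : g =ᶠ[𝓝 w] fun w => p 0 (Ring.inverse (B w) y) := by
          filter_upwards [ho] with w' hw' using hg2 w' hw'
        refine DifferentiableAt.congr_of_eventuallyEq ?_ he
        have hi : DifferentiableAt ℂ (fun w => Ring.inverse (B w)) w := by
          obtain ⟨U, hU⟩ := hw
          have := differentiableAt_inverse (𝕜 := ℂ) (hU ▸ U.isUnit : IsUnit (B w))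
          exact DifferentiableAt.comp w this (hBd w)
        exact (p 0).differentiableAt.comp w (hi.clm_apply (differentiableAt_const y))
    set D : ℝ := max (C * ‖y‖) (C * (K * ‖y‖)) with hD
    have hD0 : 0 ≤ D := le_max_of_le_left (by positivity)
    have hb1 : ∀ w : ℂ, ‖g w‖ * |‖w‖ - ‖w - 1‖| ≤ D := by
      intro w
      by_cases h : ‖w‖ < ‖w - 1‖
      · have h2 := (kt_series (fun k => p (k + 1) y) (C * ‖y‖) (hu y)).2.1 _ (hs1 w h)
        have hpos : 0 < ‖w - 1‖ := norm_pos_iff.mpr (hne w h)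
        rw [hg1 w h, abs_of_neg (by linarith)]
        simp only [hL]
        rw [norm_mul, norm_inv, norm_sub_rev 1 w]
        refine le_trans (le_of_eq ?_) (h2.trans (le_max_left _ _))
        rw [norm_div]
        field_simp
        ring
      · have h' := not_lt.mp h
        have hw := hBu w h'
        rw [hg2 w hw, abs_of_nonneg (by linarith)]
        have h3 := kt_res T K hpb w (Ring.inverse (B w) y) y (by
          have := hBi w hw y
          simpa [hB] using this) h'
        have h4 := (p 0).le_of_opNorm_le (hp 0) (Ring.inverse (B w) y)
        refine le_trans ?_ (le_max_right _ _)
        calc _ ≤ (C * ‖Ring.inverse (B w) y‖) * (‖w‖ - ‖w - 1‖) :=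
              mul_le_mul_of_nonneg_right h4 (by linarith)
          _ = C * (‖Ring.inverse (B w) y‖ * (‖w‖ - ‖w - 1‖)) := by ring
          _ ≤ _ := mul_le_mul_of_nonneg_left h3 hC
    have hconst := kt_liouville (fun v => g (v + 1 / 2)) (hgd.comp (by fun_prop)) D hD0 (by
      intro v _
      have h1 := hb1 (v + 1 / 2)
      have h2 := kt_norm_sq (v + 1 / 2)
      have h3 : ‖v + 1 / 2‖ ≤ ‖v‖ + 1 / 2 := (norm_add_le _ _).trans (by norm_num)
      have h4 : ‖v + 1 / 2 - 1‖ ≤ ‖v‖ + 1 / 2 := by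
        have : v + 1 / 2 - 1 = v - 1 / 2 := by ring
        rw [this]
        exact (norm_sub_le _ _).trans (by norm_num)
      set a := ‖v + 1 / 2‖
      set b := ‖v + 1 / 2 - 1‖
      have ha : 0 ≤ a := norm_nonneg _
      have hb : 0 ≤ b := norm_nonneg _
      have h5 : 2 * |v.re| = |a - b| * (a + b) := by
        rw [← abs_of_nonneg (add_nonneg ha hb), ← abs_mul, ← abs_two, ← abs_mul]
        congr 1
        simp at h2
        linarith
      rw [h5, ← mul_assoc]
      exact mul_le_mul h1 (by linarith) (by positivity) hD0)
    intro a b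
    have := hconst (a - 1 / 2) (b - 1 / 2)
    simpa using this
  obtain ⟨g, hg, hgc⟩ := main (B 2 x)
  have h2 : ‖(2 : ℂ) - 1‖ ≤ ‖(2 : ℂ)‖ := by norm_num
  have h1 : ‖(1 : ℂ) - 1‖ ≤ ‖(1 : ℂ)‖ := by norm_num
  have e := hgc 1 2
  rw [hg 1 h1, hg 2 h2, hBi' 2 (hBu 2 h2)] at e
  have hB1 : B 1 = 1 := by simp [hB]
  rw [hB1, Ring.inverse_one] at e
  have hB2 : B 2 x = (2 : ℂ) • x - T x := by
    simp only [hB]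
    norm_num
  rw [one_apply_eq_self, hB2, map_sub, map_smul, smul_eq_mul] at e
  linear_combination -e

/-- Strong Katznelson–Tzafriri. -/
lemma kt_strong {X : Type*} [NormedAddCommGroup X] [NormedSpace ℂ X] [CompleteSpace X]
    (T : X →L[ℂ] X) (K : ℝ) (hpb : ∀ n : ℕ, ‖T ^ n‖ ≤ K)
    (hspec : ∀ z ∈ spectrum ℂ T, ‖z‖ = 1 → z = 1) (x : X) :
    Tendsto (fun n : ℕ => ‖(T ^ n) (x - T x)‖) atTop (𝓝 0) := by
  have hK : 0 ≤ K := (norm_nonneg _).trans (hpb 0)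
  rw [tendsto_iff_ultrafilter]
  intro U hU
  choose φ hφ1 hφ2 using fun n : ℕ => exists_dual_vector'' ℂ ((T ^ n) (x - T x))
  have hbd : ∀ (k : ℕ) (y : X) (n : ℕ), ‖φ n ((T ^ (n - k)) y)‖ ≤ K * ‖y‖ := by
    intro k y n
    calc _ ≤ 1 * ‖(T ^ (n - k)) y‖ := (φ n).le_of_opNorm_le (hφ1 n) _
      _ ≤ K * ‖y‖ := by rw [one_mul]; exact (T ^ (n - k)).le_of_opNorm_le (hpb _) y
  have hlim : ∀ (k : ℕ) (y : X), ∃ c : ℂ, ‖c‖ ≤ K * ‖y‖ ∧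
      Tendsto (fun n => φ n ((T ^ (n - k)) y)) U (𝓝 c) := by
    intro k y
    have hc := isCompact_closedBall (0 : ℂ) (K * ‖y‖)
    obtain ⟨c, hc1, hc2⟩ := hc.ultrafilter_le_nhds (U.map (fun n => φ n ((T ^ (n - k)) y)))
      (by
        rw [le_principal_iff]
        exact Filter.Eventually.of_forall (f := (U : Filter ℕ)) (fun n => by simpa using hbd k y n))
    exact ⟨c, by simpa using hc1, hc2⟩
  choose q hq1 hq2 using hlim
  let p : ℕ → X →L[ℂ] ℂ := fun k => LinearMap.mkContinuous
    { toFun := q k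
      map_add' := fun a b => by
        refine tendsto_nhds_unique (hq2 k (a + b)) ?_
        simpa using (hq2 k a).add (hq2 k b)
      map_smul' := fun c a => by
        refine tendsto_nhds_unique (hq2 k (c • a)) ?_
        simpa using (hq2 k a).const_mul c } K (hq1 k)
  have hpq : ∀ k y, p k y = q k y := fun k y => rfl
  have hcore := kt_core T K hpb hspec p K
    (fun k => LinearMap.mkContinuous_norm_le _ hK _)
    (by
      intro k y
      rw [hpq, hpq]
      refine tendsto_nhds_unique (hq2 (k + 1) (T y)) ((hq2 k y).congr' ?_)
      filter_upwards [hU (eventually_ge_atTop (k + 1))] with n hn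
      have hn' : k + 1 ≤ n := hn
      have : n - k = (n - (k + 1)) + 1 := by omega
      rw [this, pow_succ]
      rfl) x
  have h0 : p 0 (x - T x) = 0 := by rw [map_sub, hcore, sub_self]
  have h1 := hq2 0 (x - T x)
  rw [← hpq, h0] at h1
  have h2 := h1.norm
  simp only [Nat.sub_zero, hφ2, norm_zero] at h2
  refine h2.congr (fun n => ?_)
  simp only [RCLike.norm_ofReal, abs_norm]

/-- If `T` is power-bounded, mean-ergodic (i.e. `X = closure(Ran(I-T)) ⊕ Ker(I-T)`, with
corresponding projection `P` onto `Ker(I-T)`), and `σ(T) ∩ 𝕋 ⊆ {1}`, then `T^n → P`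
strongly. -/
theorem stmt6 {X : Type*} [NormedAddCommGroup X] [NormedSpace ℂ X] [CompleteSpace X]
    (T : X →L[ℂ] X) (hpb : ∃ K : ℝ, ∀ n : ℕ, ‖T ^ n‖ ≤ K)
    (hspec : ∀ z ∈ spectrum ℂ T, ‖z‖ = 1 → z = 1)
    (P : X →L[ℂ] X)
    (hproj : ∀ x, P (P x) = P x)
    (hranP : ∀ x, T (P x) = P x)
    (hfix : ∀ x, T x = x → P x = x)
    (hkerP : ∀ x, P x = 0 ↔ x ∈ closure (Set.range fun y : X => y - T y)) :
    ∀ x : X, Tendsto (fun n : ℕ => ‖(T ^ n) x - P x‖) atTop (𝓝 0) := by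
  obtain ⟨K, hK⟩ := hpb
  have hK0 : 0 ≤ K := (norm_nonneg _).trans (hK 0)
  intro x
  have hz : P (x - P x) = 0 := by rw [map_sub, hproj, sub_self]
  have hcl := (hkerP _).mp hz
  have hTP : ∀ n : ℕ, (T ^ n) (P x) = P x := by
    intro n
    induction n with
    | zero => simp
    | succ n ih => rw [pow_succ, mul_apply_eq_comp, hranP, ih]
  have e : ∀ n : ℕ, (T ^ n) x - P x = (T ^ n) (x - P x) := by
    intro n; rw [map_sub, hTP]
  simp_rw [e]
  generalize x - P x = z at hcl
  rw [Metric.tendsto_atTop]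
  intro ε hε
  obtain ⟨_, ⟨y, rfl⟩, hy⟩ := Metric.mem_closure_iff.mp hcl (ε / (2 * (K + 1))) (by positivity)
  obtain ⟨N, hN⟩ := Metric.tendsto_atTop.mp (kt_strong T K hK hspec y) (ε / 2) (by positivity)
  refine ⟨N, fun n hn => ?_⟩
  have h1 := hN n hn
  simp only [dist_zero_right, norm_norm] at h1 ⊢
  rw [dist_eq_norm, lt_div_iff₀ (by positivity)] at hy
  have h2 : ‖(T ^ n) (z - (y - T y))‖ ≤ K * ‖z - (y - T y)‖ :=
    (T ^ n).le_of_opNorm_le (hK n) _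
  have h3 : (T ^ n) z = (T ^ n) (z - (y - T y)) + (T ^ n) (y - T y) := by
    rw [← map_add, sub_add_cancel]
  have h4 := norm_add_le ((T ^ n) (z - (y - T y))) ((T ^ n) (y - T y))
  rw [← h3] at h4
  have h5 := norm_nonneg (z - (y - T y))
  nlinarith
end

section
/- Let T be a power-bounded operator on a Banach space X with σ(T) ∩ 𝕋 ⊆ {1}, suppose σ(T) ∩ 𝕋 is countable (trivially true here) and that 1 is not an eigenvalue of the adjoint T*. Then ‖T^n x‖ → 0 for every x ∈ X. -/
open Filter Topology

lemma aux_rec (b : ℕ → ℝ) (α β C M : ℝ) (hβ : 0 ≤ β) (hαβ : β < α)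
    (hM : ∀ n, b n ≤ M) (h : ∀ n, α * b n ≤ C + β * b (n + 1)) : b 0 * (α - β) ≤ C := by
  have hbd : BddAbove (Set.range b) := ⟨M, by rintro _ ⟨n, rfl⟩; exact hM n⟩
  have hs : ∀ n, b n ≤ ⨆ n, b n := fun n => le_ciSup hbd n
  have hα : 0 < α := lt_of_le_of_lt hβ hαβ
  have h2 : (⨆ n, b n) ≤ (C + β * ⨆ n, b n) / α := by
    apply ciSup_le
    intro n
    rw [le_div_iff₀ hα]
    have := mul_le_mul_of_nonneg_left (hs (n + 1)) hβ
    linarith [h n]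
  rw [le_div_iff₀ hα] at h2
  have := mul_le_mul_of_nonneg_right (hs 0) (sub_pos.2 hαβ).le
  nlinarith

/-- If an entire function satisfies a bound with a singularity on a line, it is constant. -/
lemma aux_liouville (h : ℂ → ℂ) (hd : Differentiable ℂ h) (C : ℝ)
    (hb : ∀ w : ℂ, w.re ≠ -1/2 →
      ‖h w‖ * |‖1 + w‖ - ‖w‖| ≤ C) (w : ℂ) : h w = h 0 := by
  have hC : 0 ≤ C := le_trans (by positivity) (hb 0 (by norm_num))
  have key : ∀ u : ℂ, ‖h (u - 1/2)‖ ≤ 4 * C := by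
    intro u
    set R : ℝ := 2 * ‖u‖ + 1 with hR
    have hR1 : 1 ≤ R := by have := norm_nonneg u; linarith
    have hmax : ‖h (u - 1/2) * (u ^ 2 + R ^ 2)‖ ≤ C * R * (2 * R + 1) := by
      refine Complex.norm_le_of_forall_mem_frontier_norm_le (U := Metric.ball (0:ℂ) R)
        (f := fun u : ℂ => h (u - 1/2) * (u ^ 2 + R ^ 2)) Metric.isBounded_ball ?_ ?_ ?_
      · apply Differentiable.diffContOnCl
        have : Differentiable ℂ (fun u : ℂ => h (u - 1/2)) := hd.comp (by fun_prop)
        fun_prop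
      · intro v hv
        rw [frontier_ball _ (by linarith)] at hv
        have hv : ‖v‖ = R := by simpa using hv
        have hnorm : v.re ^ 2 + v.im ^ 2 = R ^ 2 := by
          rw [← hv, Complex.sq_norm, Complex.normSq_apply]; ring
        have hfac : v ^ 2 + (R:ℂ) ^ 2 = 2 * v.re * v := by
          have h1 : (R:ℂ) ^ 2 = (v.re : ℂ) ^ 2 + (v.im : ℂ) ^ 2 := by
            exact_mod_cast hnorm.symm
          rw [h1]
          apply Complex.ext
          · simp [pow_two]; ring
          · simp [pow_two]; ring
        have hn : ‖v ^ 2 + (R:ℂ) ^ 2‖ = 2 * |v.re| * R := by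
          rw [hfac]; simp [hv]
        simp only [norm_mul, hn]
        by_cases h0 : v.re = 0
        · simp [h0]; positivity
        have hb' := hb (v - 1/2) (by
          simp only [Complex.sub_re]; norm_num; intro h; apply h0; linarith)
        have e1 : (1:ℂ) + (v - 1/2) = v + 1/2 := by ring
        rw [e1] at hb'
        set p := ‖v + 1/2‖
        set q := ‖v - 1/2‖
        have hpq : p ^ 2 - q ^ 2 = 2 * v.re := by
          simp only [p, q, Complex.sq_norm, Complex.normSq_apply]
          simp
          ring
        have hp : p ≤ R + 1/2 := by
          have := norm_add_le v (1/2); rw [hv] at this; norm_num at this ⊢; exact this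
        have hq : q ≤ R + 1/2 := by
          have := norm_sub_le v (1/2); rw [hv] at this; norm_num at this ⊢; exact this
        have hp0 : 0 ≤ p := norm_nonneg _
        have hq0 : 0 ≤ q := norm_nonneg _
        have e2 : 2 * |v.re| = |p - q| * (p + q) := by
          have e3 : (p - q) * (p + q) = 2 * v.re := by rw [← hpq]; ring
          have e4 := congrArg abs e3
          rw [abs_mul, abs_mul, abs_of_nonneg (add_nonneg hp0 hq0)] at e4
          rw [e4]; norm_num
        rw [e2]
        calc ‖h (v - 1/2)‖ * (|p - q| * (p + q) * R)
            = (‖h (v - 1/2)‖ * |p - q|) * ((p + q) * R) := by ring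
          _ ≤ C * ((2 * R + 1) * R) := by
            have e5 : p + q ≤ 2 * R + 1 := by linarith
            gcongr
          _ = C * R * (2 * R + 1) := by ring
      · apply subset_closure
        simp [hR]
        have := norm_nonneg u; linarith
    have hlow : 3/4 * R ^ 2 ≤ ‖u ^ 2 + (R:ℂ) ^ 2‖ := by
      have h1 : ‖(R:ℂ) ^ 2‖ - ‖u ^ 2‖ ≤ ‖u ^ 2 + (R:ℂ) ^ 2‖ := by
        have := norm_sub_norm_le ((R:ℂ) ^ 2) (-u ^ 2)
        simpa [add_comm] using this
      have h2 : ‖(R:ℂ) ^ 2‖ = R ^ 2 := by simp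
      have h3 : ‖u ^ 2‖ = ‖u‖ ^ 2 := by simp
      rw [h2, h3] at h1
      have h4 : 2 * ‖u‖ ≤ R := by linarith
      nlinarith [norm_nonneg u]
    rw [norm_mul] at hmax
    have h5 : ‖h (u - 1/2)‖ * (3/4 * R ^ 2) ≤ (4 * C) * (3/4 * R ^ 2) := by
      calc _ ≤ ‖h (u - 1/2)‖ * ‖u ^ 2 + (R:ℂ) ^ 2‖ := by gcongr
        _ ≤ C * R * (2 * R + 1) := hmax
        _ ≤ C * R * (3 * R) := by gcongr; linarith
        _ = _ := by ring
    exact le_of_mul_le_mul_right h5 (by positivity)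
  apply hd.apply_eq_apply_of_bounded
  rw [isBounded_iff_forall_norm_le]
  refine ⟨4 * C, ?_⟩
  rintro _ ⟨w, rfl⟩
  have := key (w + 1/2)
  simpa using this

lemma aux_norm_sq (w : ℂ) : ‖1 + w‖ ^ 2 - ‖w‖ ^ 2 = 1 + 2 * w.re := by
  simp only [Complex.sq_norm, Complex.normSq_apply]
  simp
  ring

lemma aux_lt (w : ℂ) (h : -1/2 < w.re) : ‖w‖ < ‖1 + w‖ := by
  have := aux_norm_sq w
  apply lt_of_pow_lt_pow_left₀ 2 (norm_nonneg _)
  linarith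

lemma aux_gt (w : ℂ) (h : w.re < -1/2) : ‖1 + w‖ < ‖w‖ := by
  have := aux_norm_sq w
  apply lt_of_pow_lt_pow_left₀ 2 (norm_nonneg _)
  linarith

/-- a bounded power series is differentiable on the disc -/
lemma aux_series (c : ℕ → ℂ) (C : ℝ) (hc : ∀ n, ‖c n‖ ≤ C) (z : ℂ) (hz : ‖z‖ < 1) :
    DifferentiableAt ℂ (fun z : ℂ => ∑' n, z ^ n * c n) z := by
  obtain ⟨r, hr1, hr2⟩ := exists_between hz
  have hr0 : 0 ≤ r := (norm_nonneg z).trans hr1.le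
  have : DifferentiableOn ℂ (fun z : ℂ => ∑' n, z ^ n * c n) (Metric.ball 0 r) := by
    apply Complex.differentiableOn_tsum_of_summable_norm (u := fun n => r ^ n * C)
    · exact (summable_geometric_of_lt_one hr0 hr2).mul_right C
    · intro n; fun_prop
    · exact Metric.isOpen_ball
    · intro n w hw
      have hw : ‖w‖ < r := by simpa using hw
      rw [norm_mul, norm_pow]
      gcongr
      exact hc n
  exact this.differentiableAt (Metric.isOpen_ball.mem_nhds (by simpa using hr1))

section
variable {X : Type*} [NormedAddCommGroup X] [NormedSpace ℂ X] [CompleteSpace X]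

lemma aux_core (T : X →L[ℂ] X) (K : ℝ) (hK : ∀ n : ℕ, ‖T ^ n‖ ≤ K)
    (hunit : ∀ w : ℂ, -1/2 ≤ w.re → IsUnit (1 + w • (1 - T)))
    (Φ : ℕ → X →L[ℂ] ℂ) (hΦ : ∀ m y, Φ (m + 1) (T y) = Φ m y)
    (C : ℝ) (hC : ∀ m y, ‖Φ m y‖ ≤ C * ‖y‖) (x : X) : Φ 0 (x - T x) = 0 := by
  classical
  set S : ℂ → (X →L[ℂ] X) := fun w => 1 + w • (1 - T) with hS
  set V : ℂ → X := fun w => Ring.inverse (S w) x with hV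
  have hVeq : ∀ w, IsUnit (S w) → V w + w • (V w - T (V w)) = x := by
    intro w hw
    have h1 := Ring.mul_inverse_cancel _ hw
    have h2 := congrArg (fun A : X →L[ℂ] X => A x) h1
    simpa [hS, hV] using h2
  set c : ℕ → ℂ := fun j => Φ (j + 1) x with hc
  set L : ℂ → ℂ := fun w => -w⁻¹ * ∑' j, ((1 + w) / w) ^ j * c j with hL
  have hcb : ∀ n, ‖c n‖ ≤ C * ‖x‖ := fun n => hC _ _
  have hCx : 0 ≤ C * ‖x‖ := (norm_nonneg _).trans (hcb 0)
  have hzlt : ∀ w : ℂ, w.re < -1/2 → w ≠ 0 ∧ ‖(1 + w) / w‖ < 1 := by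
    intro w hw
    have h0 : w ≠ 0 := by rintro rfl; norm_num at hw
    refine ⟨h0, ?_⟩
    rw [norm_div, div_lt_one (norm_pos_iff.2 h0)]
    exact aux_gt w hw
  have hsum : ∀ w : ℂ, w.re < -1/2 → Summable fun j => ((1 + w) / w) ^ j * c j := by
    intro w hw
    apply Summable.of_norm_bounded
      ((summable_geometric_of_lt_one (norm_nonneg _) (hzlt w hw).2).mul_right (C * ‖x‖))
    intro j
    rw [norm_mul, norm_pow]
    gcongr
    exact hcb j
  -- agreement
  have hagree : ∀ w : ℂ, w.re < -1/2 → IsUnit (S w) → Φ 0 (V w) = L w := by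
    intro w hw hu
    obtain ⟨h0, hz⟩ := hzlt w hw
    set z := (1 + w) / w with hzdef
    set v := V w with hv
    have hrec : ∀ m, Φ m v = z * Φ (m + 1) v - w⁻¹ * c m := by
      intro m
      have h1 := congrArg (Φ (m + 1)) (hVeq w hu)
      simp only [map_add, map_smul, map_sub, hΦ, smul_eq_mul] at h1
      rw [hc, hzdef]
      simp only
      rw [← h1]
      field_simp
      ring
    have hit : ∀ N, Φ 0 v = z ^ N * Φ N v - w⁻¹ * ∑ j ∈ Finset.range N, z ^ j * c j := by
      intro N
      induction N with
      | zero => simp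
      | succ N ih =>
        rw [ih, Finset.sum_range_succ, hrec N]
        ring
    have ht1 : Tendsto (fun N => z ^ N * Φ N v) atTop (𝓝 0) := by
      apply squeeze_zero_norm (a := fun N => ‖z‖ ^ N * (C * ‖v‖))
      · intro N
        rw [norm_mul, norm_pow]
        gcongr
        exact hC _ _
      · simpa using (tendsto_pow_atTop_nhds_zero_of_lt_one (norm_nonneg z) hz).mul_const (C * ‖v‖)
    have ht2 := (hsum w hw).hasSum.tendsto_sum_nat
    have ht3 := ht1.sub (ht2.const_mul w⁻¹)
    have ht4 : Tendsto (fun _ : ℕ => Φ 0 v) atTop (𝓝 (Φ 0 v)) := tendsto_const_nhds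
    have := tendsto_nhds_unique ht4 (ht3.congr (fun N => (hit N).symm))
    rw [this, hL]
    simp only
    ring
  set h : ℂ → ℂ := fun w => if IsUnit (S w) then Φ 0 (V w) else L w with hh
  have hhu : ∀ w, IsUnit (S w) → h w = Φ 0 (V w) := fun w hw => if_pos hw
  have hhl : ∀ w : ℂ, w.re < -1/2 → h w = L w := by
    intro w hw
    by_cases hu : IsUnit (S w)
    · rw [hhu w hu, hagree w hw hu]
    · exact if_neg hu
  have hSd : Differentiable ℂ S := by
    rw [hS]; fun_prop
  have hVd : ∀ w, IsUnit (S w) → DifferentiableAt ℂ V w := by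
    intro w hw
    obtain ⟨u, hu⟩ := hw
    have h1 : DifferentiableAt ℂ (Ring.inverse : (X →L[ℂ] X) → _) (S w) := by
      rw [← hu]; exact (hasFDerivAt_ringInverse (𝕜 := ℂ) u).differentiableAt
    have h2 : DifferentiableAt ℂ (fun w => Ring.inverse (S w)) w :=
      h1.comp w (hSd w)
    exact h2.clm_apply (differentiableAt_const x)
  have hd : Differentiable ℂ h := by
    intro w
    by_cases hu : IsUnit (S w)
    · have hev : h =ᶠ[𝓝 w] fun w => Φ 0 (V w) := by
        have : ∀ᶠ w' in 𝓝 w, IsUnit (S w') :=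
          hSd.continuous.continuousAt.eventually (Units.isOpen.mem_nhds hu)
        filter_upwards [this] with w' hw' using hhu w' hw'
      refine DifferentiableAt.congr_of_eventuallyEq ?_ hev
      exact (Φ 0).differentiableAt.comp w (hVd w hu)
    · have hw : w.re < -1/2 := by
        by_contra hcon
        exact hu (hunit w (not_lt.1 hcon))
      have hev : h =ᶠ[𝓝 w] L := by
        have : ∀ᶠ w' : ℂ in 𝓝 w, w'.re < -1/2 :=
          Complex.continuous_re.continuousAt.eventually (gt_mem_nhds hw)
        filter_upwards [this] with w' hw' using hhl w' hw'
      refine DifferentiableAt.congr_of_eventuallyEq ?_ hev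
      obtain ⟨h0, hz⟩ := hzlt w hw
      have h1 : DifferentiableAt ℂ (fun w : ℂ => (1 + w) / w) w := by
        apply DifferentiableAt.div _ _ h0 <;> fun_prop
      have h2 : DifferentiableAt ℂ (fun w : ℂ => ∑' j, ((1 + w) / w) ^ j * c j) w :=
        DifferentiableAt.comp (g := fun z : ℂ => ∑' n, z ^ n * c n)
          (f := fun w : ℂ => (1 + w) / w) w (aux_series c _ hcb _ hz) h1
      exact ((differentiableAt_inv h0).neg).mul h2
  have hK0 : 0 ≤ K := (norm_nonneg _).trans (hK 0)
  have hbound : ∀ w : ℂ, w.re ≠ -1/2 →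
      ‖h w‖ * |‖1 + w‖ - ‖w‖| ≤ max (C * ‖x‖) (|C| * (K * ‖x‖)) := by
    intro w hw
    rcases lt_or_gt_of_ne hw with hw | hw
    · refine le_trans ?_ (le_max_left _ _)
      obtain ⟨h0, hz⟩ := hzlt w hw
      have hlt := aux_gt w hw
      rw [hhl w hw, abs_sub_comm, abs_of_pos (sub_pos.2 hlt)]
      have hg : ‖∑' j, ((1 + w) / w) ^ j * c j‖ ≤ (1 - ‖(1 + w) / w‖)⁻¹ * (C * ‖x‖) := by
        apply tsum_of_norm_bounded ((hasSum_geometric_of_lt_one (norm_nonneg _) hz).mul_right _)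
        intro j
        rw [norm_mul, norm_pow]
        gcongr
        exact hcb j
      have hwpos : 0 < ‖w‖ := norm_pos_iff.2 h0
      have h1z : 0 < 1 - ‖(1 + w) / w‖ := by linarith
      have e : ‖w‖ - ‖1 + w‖ = ‖w‖ * (1 - ‖(1 + w) / w‖) := by
        rw [norm_div]; field_simp
      rw [hL, e]
      simp only [norm_mul, norm_neg, norm_inv]
      calc _ = ‖∑' j, ((1 + w) / w) ^ j * c j‖ * (1 - ‖(1 + w) / w‖) := by
            field_simp
        _ ≤ (1 - ‖(1 + w) / w‖)⁻¹ * (C * ‖x‖) * (1 - ‖(1 + w) / w‖) := by gcongr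
        _ = C * ‖x‖ := by field_simp
    · refine le_trans ?_ (le_max_right _ _)
      have hlt := aux_lt w hw
      have hu : IsUnit (S w) := hunit w hw.le
      rw [hhu w hu, abs_of_pos (sub_pos.2 hlt)]
      set v := V w with hv
      have hTn : ∀ n (y : X), ‖Φ 0 ((T ^ n) y)‖ ≤ |C| * (K * ‖y‖) := by
        intro n y
        calc _ ≤ C * ‖(T ^ n) y‖ := hC _ _
          _ ≤ |C| * ‖(T ^ n) y‖ := by gcongr; exact le_abs_self C
          _ ≤ |C| * (K * ‖y‖) := by
            gcongr; exact (T ^ n).le_of_opNorm_le (hK n) y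
      have := aux_rec (fun n => ‖Φ 0 ((T ^ n) v)‖) ‖1 + w‖ ‖w‖ (|C| * (K * ‖x‖)) _
        (norm_nonneg _) hlt (fun n => hTn n v) ?_
      · simpa using this
      · intro n
        have h1 := congrArg (fun y => Φ 0 ((T ^ n) y)) (hVeq w hu)
        have h2 : (T ^ n) (T v) = (T ^ (n + 1)) v := by rw [pow_succ]; rfl
        simp only [map_add, map_smul, map_sub, smul_eq_mul, ← hv, h2] at h1
        have h3 : (1 + w) * Φ 0 ((T ^ n) v) = Φ 0 ((T ^ n) x) + w * Φ 0 ((T ^ (n + 1)) v) := by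
          rw [← h1]; ring
        rw [← norm_mul, h3, ← norm_mul]
        exact (norm_add_le _ _).trans (by gcongr; exact hTn n x)
  have hconst := aux_liouville h hd _ hbound
  have hS0 : S 0 = 1 := by simp [hS]
  have hu0 : IsUnit (S 0) := by rw [hS0]; exact isUnit_one
  have hV0 : V 0 = x := by simp [hV, hS0]
  have hlim : Tendsto (fun w => Φ 0 (V w - T (V w))) (𝓝[≠] 0) (𝓝 (Φ 0 (x - T x))) := by
    have hVc : Tendsto V (𝓝[≠] 0) (𝓝 x) := by
      have := (hVd 0 hu0).continuousAt.tendsto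
      rw [hV0] at this
      exact this.mono_left nhdsWithin_le_nhds
    exact ((Φ 0).continuous.tendsto _).comp (hVc.sub ((T.continuous.tendsto _).comp hVc))
  have hzero : (fun w => Φ 0 (V w - T (V w))) =ᶠ[𝓝[≠] 0] fun _ => 0 := by
    have : ∀ᶠ w in 𝓝 (0:ℂ), IsUnit (S w) :=
      hSd.continuous.continuousAt.eventually (Units.isOpen.mem_nhds hu0)
    filter_upwards [nhdsWithin_le_nhds this, self_mem_nhdsWithin] with w hw hne
    have h1 := congrArg (Φ 0) (hVeq w hw)
    have h2 := hconst w
    rw [hhu w hw, hhu 0 hu0, hV0] at h2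
    rw [map_add, map_smul, h2] at h1
    have h3 : w • Φ 0 (V w - T (V w)) = 0 := by simpa using h1
    exact (smul_eq_zero.1 h3).resolve_left hne
  exact tendsto_nhds_unique (hlim.congr' hzero) tendsto_const_nhds |>.trans rfl

lemma aux_KT (T : X →L[ℂ] X) (K : ℝ) (hK : ∀ n : ℕ, ‖T ^ n‖ ≤ K)
    (hunit : ∀ w : ℂ, -1/2 ≤ w.re → IsUnit (1 + w • (1 - T))) (x : X) :
    Tendsto (fun n : ℕ => ‖(T ^ n) (x - T x)‖) atTop (𝓝 0) := by
  by_contra hcon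
  have hK0 : 0 ≤ K := (norm_nonneg _).trans (hK 0)
  obtain ⟨ε, hε, hfr⟩ : ∃ ε > 0, ∃ᶠ n : ℕ in atTop, ε ≤ ‖(T ^ n) (x - T x)‖ := by
    by_contra hno
    push Not at hno
    apply hcon
    rw [Metric.tendsto_nhds]
    intro ε hε
    have := hno ε hε
    filter_upwards [this] with n hn
    simpa using hn
  have hne : NeBot (atTop ⊓ 𝓟 {n : ℕ | ε ≤ ‖(T ^ n) (x - T x)‖}) := by
    exact frequently_mem_iff_neBot.1 hfr
  set U : Ultrafilter ℕ := Ultrafilter.of (atTop ⊓ 𝓟 {n : ℕ | ε ≤ ‖(T ^ n) (x - T x)‖})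
  have hU : (U : Filter ℕ) ≤ atTop ⊓ 𝓟 {n : ℕ | ε ≤ ‖(T ^ n) (x - T x)‖} := Ultrafilter.of_le _
  have hUtop : (U : Filter ℕ) ≤ atTop := hU.trans inf_le_left
  have hUs : ∀ᶠ n in (U : Filter ℕ), ε ≤ ‖(T ^ n) (x - T x)‖ :=
    (hU.trans inf_le_right) (mem_principal_self _)
  choose f hf1 hf2 using fun n : ℕ => exists_dual_vector'' ℂ ((T ^ n) (x - T x))
  have hex : ∀ m : ℕ, ∃ Φ : X →L[ℂ] ℂ, (∀ y, ‖Φ y‖ ≤ K * ‖y‖) ∧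
      ∀ y, Tendsto (fun n => f n ((T ^ (n - m)) y)) U (𝓝 (Φ y)) := by
    intro m
    have hcomp := WeakDual.isCompact_closedBall (𝕜 := ℂ) (E := X) 0 K
    let g : ℕ → WeakDual ℂ X := fun n => StrongDual.toWeakDual ((f n).comp (T ^ (n - m)))
    have hg : ∀ n, g n ∈ (WeakDual.toStrongDual ⁻¹' Metric.closedBall (0 : StrongDual ℂ X) K) := by
      intro n
      simp only [Set.mem_preimage, mem_closedBall_zero_iff]
      change ‖(f n).comp (T ^ (n - m))‖ ≤ K
      calc _ ≤ ‖f n‖ * ‖T ^ (n - m)‖ := ContinuousLinearMap.opNorm_comp_le _ _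
        _ ≤ 1 * K := by gcongr; exacts [hf1 n, hK _]
        _ = K := one_mul K
    obtain ⟨Φ, hΦ1, hΦ2⟩ := hcomp.ultrafilter_le_nhds (U.map g) (by
      rw [le_principal_iff]
      exact Filter.mem_map.2 (Filter.univ_mem' hg))
    refine ⟨WeakDual.toStrongDual Φ, ?_, ?_⟩
    · intro y
      simp only [Set.mem_preimage, mem_closedBall_zero_iff] at hΦ1
      exact ContinuousLinearMap.le_of_opNorm_le _ hΦ1 y
    · intro y
      have h1 : Tendsto g U (𝓝 Φ) := hΦ2
      exact ((WeakDual.eval_continuous y).tendsto Φ).comp h1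
  choose Φ hΦ1 hΦ2 using hex
  have h0 := aux_core T K hK hunit Φ ?_ K hΦ1 x
  · have h1 := (hΦ2 0 (x - T x)).norm
    rw [h0, norm_zero] at h1
    have h2 : ε ≤ 0 := by
      apply ge_of_tendsto h1
      filter_upwards [hUs] with n hn
      simp only [Nat.sub_zero, hf2]
      simpa using hn
    linarith
  · intro m y
    refine tendsto_nhds_unique (hΦ2 (m + 1) (T y)) ((hΦ2 m y).congr' ?_)
    filter_upwards [hUtop (eventually_ge_atTop (m + 1))] with n hn
    have : n - m = n - (m + 1) + 1 := by omega
    rw [this, pow_succ]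
    rfl

lemma aux_unit (T : X →L[ℂ] X) (K : ℝ) (hK : ∀ n : ℕ, ‖T ^ n‖ ≤ K)
    (hspec : ∀ z ∈ spectrum ℂ T, ‖z‖ = 1 → z = 1)
    (w : ℂ) (hw : -1/2 ≤ w.re) : IsUnit (1 + w • (1 - T)) := by
  by_cases h0 : w = 0
  · simp [h0]
  by_contra hnu
  have hmem : (1 + w) / w ∈ spectrum ℂ T := by
    rw [spectrum.mem_iff]
    intro hu
    apply hnu
    have h1 : (1 : X →L[ℂ] X) + w • (1 - T) =
        (algebraMap ℂ (X →L[ℂ] X) w) * (algebraMap ℂ (X →L[ℂ] X) ((1 + w) / w) - T) := by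
      rw [Algebra.algebraMap_eq_smul_one, Algebra.algebraMap_eq_smul_one, smul_mul_assoc, one_mul,
        smul_sub, smul_sub, smul_smul, mul_div_cancel₀ _ h0, add_smul, one_smul]
      abel
    rw [h1]
    exact ((IsUnit.mk0 w h0).map (algebraMap ℂ (X →L[ℂ] X))).mul hu
  set z := (1 + w) / w with hz
  have hle : ‖z‖ ≤ 1 := by
    by_contra hgt
    push Not at hgt
    have hb : ∀ n : ℕ, ‖z‖ ^ n ≤ K * ‖(1 : X →L[ℂ] X)‖ := by
      intro n
      have h1 := spectrum.norm_le_norm_mul_of_mem (spectrum.pow_mem_pow T n hmem)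
      rw [norm_pow] at h1
      exact h1.trans (by gcongr; exact hK n)
    obtain ⟨n, hn⟩ := pow_unbounded_of_one_lt (K * ‖(1 : X →L[ℂ] X)‖) hgt
    linarith [hb n]
  have hge : 1 ≤ ‖z‖ := by
    rw [hz, norm_div, one_le_div (norm_pos_iff.2 h0)]
    have := aux_norm_sq w
    apply (pow_le_pow_iff_left₀ (norm_nonneg _) (norm_nonneg _) two_ne_zero).1
    linarith
  have := hspec z hmem (le_antisymm hle hge)
  rw [hz, div_eq_one_iff_eq h0] at this
  simp at this

end

/-- Special case of the ABLV theorem: if `T` is power-bounded, `σ(T) ∩ 𝕋 ⊆ {1}` and `1`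
is not an eigenvalue of `T*`, then all orbits of `T` tend to zero. -/
theorem stmt11 {X : Type*} [NormedAddCommGroup X] [NormedSpace ℂ X] [CompleteSpace X]
    (T : X →L[ℂ] X) (hpb : ∃ K : ℝ, ∀ n : ℕ, ‖T ^ n‖ ≤ K)
    (hspec : ∀ z ∈ spectrum ℂ T, ‖z‖ = 1 → z = 1)
    (heig : ∀ f : X →L[ℂ] ℂ, f.comp T = f → f = 0) :
    ∀ x : X, Tendsto (fun n : ℕ => ‖(T ^ n) x‖) atTop (𝓝 0) := by
  obtain ⟨K, hK⟩ := hpb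
  have hK0 : 0 ≤ K := (norm_nonneg _).trans (hK 0)
  have hKT := aux_KT T K hK (aux_unit T K hK hspec)
  intro x
  -- density of the range of `1 - T`
  set p : Submodule ℂ X := LinearMap.range ((1 - T : X →L[ℂ] X) : X →ₗ[ℂ] X) with hp
  have hdense : x ∈ closure (p : Set X) := by
    by_contra hx
    have hx' : x ∉ p.topologicalClosure := hx
    have : IsClosed (p.topologicalClosure : Set X) := p.isClosed_topologicalClosure
    have hq : (Submodule.Quotient.mk x : X ⧸ p.topologicalClosure) ≠ 0 := by
      rw [Ne, Submodule.Quotient.mk_eq_zero]; exact hx'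
    obtain ⟨g, -, hg⟩ := exists_dual_vector ℂ _ (norm_ne_zero_iff.2 hq)
    have hz := heig (g.comp p.topologicalClosure.mkQL) (by
      ext u
      have hu : (Submodule.Quotient.mk (T u) : X ⧸ p.topologicalClosure) =
          Submodule.Quotient.mk u := by
        symm
        rw [Submodule.Quotient.eq]
        exact p.le_topologicalClosure ⟨u, by simp⟩
      exact congrArg g hu)
    have h1 : g (Submodule.Quotient.mk x) = 0 := DFunLike.congr_fun hz x
    rw [h1] at hg
    have h2 : ‖(Submodule.Quotient.mk x : X ⧸ p.topologicalClosure)‖ = 0 := by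
      exact Complex.ofReal_eq_zero.1 hg.symm
    exact hq (norm_eq_zero.1 h2)
  rw [Metric.tendsto_nhds]
  intro ε hε
  obtain ⟨y, hy, hxy⟩ := Metric.mem_closure_iff.1 hdense (ε / (2 * (K + 1))) (by positivity)
  obtain ⟨u, rfl⟩ := hy
  have := (Metric.tendsto_nhds.1 (hKT u)) (ε / 2) (by positivity)
  filter_upwards [this] with n hn
  have hn : ‖(T ^ n) (u - T u)‖ < ε / 2 := by simpa using hn
  have hxy : ‖x - (u - T u)‖ < ε / (2 * (K + 1)) := by simpa [dist_eq_norm] using hxy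
  have h1 : ‖(T ^ n) (x - (u - T u))‖ ≤ K * ‖x - (u - T u)‖ := (T ^ n).le_of_opNorm_le (hK n) _
  have h2 : K * ‖x - (u - T u)‖ ≤ ε / 2 := by
    calc _ ≤ (K + 1) * (ε / (2 * (K + 1))) := by gcongr; linarith
      _ = ε / 2 := by field_simp
  have h3 : (T ^ n) x = (T ^ n) (x - (u - T u)) + (T ^ n) (u - T u) := by
    rw [← map_add]; simp
  have h4 := norm_add_le ((T ^ n) (x - (u - T u))) ((T ^ n) (u - T u))
  rw [← h3] at h4
  rw [dist_zero_right, norm_norm]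
  linarith
end

section
/- Let T be a power-bounded operator on a complex Banach space, let g ∈ ℓ¹(ℤ) (with coefficients a_k, k ∈ ℤ), and suppose that the function θ ↦ Σ_k a_k e^{ikθ} vanishes on an open neighbourhood in 𝕋 of σ(T) ∩ 𝕋. Then, interpreting T^m = 0 for m < 0, one has Σ_{k∈ℤ} a_k T^{n+k} = (1/2π) ∫_{−π}^{π} e^{i(n+1)θ} g(e^{iθ}) (e^{iθ}I − T)^{−1} dθ for every n ≥ 0, and hence ‖Σ_{k∈ℤ} a_k T^{n+k}‖ → 0 as n → ∞ by the Riemann–Lebesgue lemma. -/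
open Filter Topology


namespace KT

variable {X : Type*} [NormedAddCommGroup X] [NormedSpace ℂ X]

/-- The extended powers of `T`. -/
noncomputable def P (T : X →L[ℂ] X) (m : ℤ) : X →L[ℂ] X := if 0 ≤ m then T ^ m.toNat else 0

/-- The sums `Σ a_k T^{n+k}`. -/
noncomputable def S (T : X →L[ℂ] X) (a : ℤ → ℂ) (n : ℤ) : X →L[ℂ] X := ∑' k : ℤ, a k • P T (n + k)

/-- The function `g`. -/
noncomputable def g (a : ℤ → ℂ) (θ : ℝ) : ℂ := ∑' k : ℤ, a k * Complex.exp (θ * Complex.I) ^ k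

/-- `g` times the resolvent. -/
noncomputable def h (T : X →L[ℂ] X) (a : ℤ → ℂ) (θ : ℝ) : X →L[ℂ] X :=
  g a θ • Ring.inverse (algebraMap ℂ (X →L[ℂ] X) (Complex.exp (θ * Complex.I)) - T)

/-- The integrals. -/
noncomputable def J (T : X →L[ℂ] X) (a : ℤ → ℂ) (n : ℤ) : X →L[ℂ] X :=
  (2 * Real.pi)⁻¹ • ∫ θ in (-Real.pi)..Real.pi,
    Complex.exp (((n : ℂ) + 1) * θ * Complex.I) • h T a θ

lemma P_bound (T : X →L[ℂ] X) {K : ℝ} (hK : ∀ n : ℕ, ‖T ^ n‖ ≤ K) (m : ℤ) : ‖P T m‖ ≤ K := by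
  unfold P
  split_ifs
  · exact hK _
  · simpa using (norm_nonneg _).trans (hK 0)

lemma P_succ (T : X →L[ℂ] X) (m : ℤ) :
    P T (m + 1) = T * P T m + if m = -1 then 1 else 0 := by
  unfold P
  rcases lt_trichotomy m (-1) with hm | hm | hm
  · rw [if_neg (by omega), if_neg (by omega), if_neg (by omega)]; simp
  · subst hm; simp
  · have h1 : (m + 1).toNat = m.toNat + 1 := by omega
    rw [if_pos (by omega), if_pos (by omega), if_neg (by omega), h1, pow_succ']; simp

lemma S_summable [CompleteSpace X] (T : X →L[ℂ] X) {K : ℝ} (hK : ∀ n : ℕ, ‖T ^ n‖ ≤ K)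
    (a : ℤ → ℂ) (ha : Summable fun k : ℤ => ‖a k‖) (n : ℤ) :
    Summable fun k : ℤ => a k • P T (n + k) := by
  refine Summable.of_norm_bounded (ha.mul_right K) fun k => ?_
  rw [norm_smul]
  exact mul_le_mul_of_nonneg_left (P_bound T hK _) (norm_nonneg _)

lemma S_succ [CompleteSpace X] (T : X →L[ℂ] X) {K : ℝ} (hK : ∀ n : ℕ, ‖T ^ n‖ ≤ K)
    (a : ℤ → ℂ) (ha : Summable fun k : ℤ => ‖a k‖) (n : ℤ) :
    S T a (n + 1) = T * S T a n + a (-n - 1) • 1 := by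
  have h1 : HasSum (fun k : ℤ => T * (a k • P T (n + k))) (T * S T a n) :=
    (S_summable T hK a ha n).hasSum.mul_left T
  have h2 : HasSum (fun k : ℤ => if k = -n - 1 then a (-n - 1) • (1 : X →L[ℂ] X) else 0)
      (a (-n - 1) • 1) := hasSum_ite_eq _ _
  have h3 := h1.add h2
  rw [← h3.tsum_eq]
  unfold S
  refine tsum_congr fun k => ?_
  rw [show n + 1 + k = n + k + 1 by ring, P_succ, smul_add, mul_smul_comm]
  congr 1
  by_cases hk : k = -n - 1
  · rw [if_pos hk, if_pos (by omega), hk]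
  · rw [if_neg hk, if_neg (by omega), smul_zero]

lemma S_tendsto [CompleteSpace X] (T : X →L[ℂ] X) {K : ℝ} (hK : ∀ n : ℕ, ‖T ^ n‖ ≤ K)
    (a : ℤ → ℂ) (ha : Summable fun k : ℤ => ‖a k‖) :
    Tendsto (S T a) atBot (𝓝 0) := by
  have := tendsto_tsum_of_dominated_convergence (𝓕 := (atBot : Filter ℤ))
    (f := fun n k => a k • P T (n + k)) (g := fun _ => 0) (ha.mul_right K) ?_ ?_
  · rw [tsum_zero] at this
    exact this
  · intro k
    refine tendsto_const_nhds.congr' ?_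
    filter_upwards [eventually_lt_atBot (-k)] with n hn
    unfold P
    rw [if_neg (by omega), smul_zero]
  · refine Eventually.of_forall fun n k => ?_
    rw [norm_smul]
    exact mul_le_mul_of_nonneg_left (P_bound T hK _) (norm_nonneg _)

lemma J_tendsto (T : X →L[ℂ] X) (a : ℤ → ℂ) : Tendsto (J T a) cofinite (𝓝 0) := by
  let f : ℝ → X →L[ℂ] X := (Set.Ioc (-Real.pi) Real.pi).indicator (h T a)
  have h1 := Real.tendsto_integral_exp_smul_cocompact f
  have h2 : Tendsto (fun n : ℤ => -((n : ℝ) + 1) / (2 * Real.pi)) cofinite (cocompact ℝ) := by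
    have e1 : Tendsto (fun n : ℤ => (n : ℝ)) cofinite (cocompact ℝ) :=
      Int.tendsto_coe_cofinite
    let e : ℝ ≃ₜ ℝ := ((Homeomorph.addRight (1 : ℝ)).trans (Homeomorph.neg ℝ)).trans
      (Homeomorph.mulRight₀ (2 * Real.pi)⁻¹ (by positivity))
    have e2 := e.isClosedEmbedding.tendsto_cocompact.comp e1
    refine e2.congr fun n => ?_
    simp [e, div_eq_mul_inv]
  have h3 := (h1.comp h2).const_smul (2 * Real.pi)⁻¹
  rw [smul_zero] at h3
  refine h3.congr fun n => ?_
  unfold J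
  simp only [Function.comp]
  congr 1
  rw [intervalIntegral.integral_of_le (by linarith [Real.pi_pos]),
    ← MeasureTheory.integral_indicator measurableSet_Ioc]
  refine MeasureTheory.integral_congr_ae (Eventually.of_forall fun θ => ?_)
  simp only [f, Set.indicator]
  split_ifs
  · rw [Circle.smul_def, Real.fourierChar_apply]
    congr 2
    have := Real.pi_ne_zero
    push_cast
    have : (Real.pi : ℂ) ≠ 0 := by exact_mod_cast this
    field_simp
  · simp

lemma norm_term (a : ℤ → ℂ) (k : ℤ) (θ : ℝ) :
    ‖a k * Complex.exp (θ * Complex.I) ^ k‖ = ‖a k‖ := by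
  rw [norm_mul, norm_zpow, Complex.norm_exp_ofReal_mul_I, one_zpow, mul_one]

lemma continuous_term (a : ℤ → ℂ) (k : ℤ) :
    Continuous fun θ : ℝ => a k * Complex.exp (θ * Complex.I) ^ k := by
  refine continuous_const.mul (Continuous.zpow₀ (by fun_prop) _ fun θ => Or.inl (Complex.exp_ne_zero _))

lemma g_continuous (a : ℤ → ℂ) (ha : Summable fun k : ℤ => ‖a k‖) : Continuous (g a) :=
  continuous_tsum (continuous_term a) ha fun k θ => (norm_term a k θ).le

lemma g_integral (a : ℤ → ℂ) (ha : Summable fun k : ℤ => ‖a k‖) (n : ℤ) :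
    ∫ θ in (-Real.pi)..Real.pi, Complex.exp (((n : ℂ) + 1) * θ * Complex.I) * g a θ
      = 2 * Real.pi * a (-n - 1) := by
  have h1 : HasSum (fun k : ℤ => ∫ θ in (-Real.pi)..Real.pi,
      Complex.exp (((n : ℂ) + 1) * θ * Complex.I) * (a k * Complex.exp (θ * Complex.I) ^ k))
      (∫ θ in (-Real.pi)..Real.pi, Complex.exp (((n : ℂ) + 1) * θ * Complex.I) * g a θ) := by
    refine intervalIntegral.hasSum_integral_of_dominated_convergence (fun k _ => ‖a k‖) ?_ ?_ ?_ ?_ ?_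
    · intro k
      exact (Continuous.mul (by fun_prop) (continuous_term a k)).aestronglyMeasurable
    · intro k
      refine Eventually.of_forall fun θ _ => ?_
      rw [norm_mul, norm_term, show ((n : ℂ) + 1) * θ * Complex.I
        = (((n + 1) * θ : ℝ) : ℂ) * Complex.I by push_cast; ring,
        Complex.norm_exp_ofReal_mul_I, one_mul]
    · exact Eventually.of_forall fun θ _ => ha
    · exact intervalIntegrable_const
    · refine Eventually.of_forall fun θ _ => ?_
      have hs : Summable fun k : ℤ => a k * Complex.exp (θ * Complex.I) ^ k :=
        Summable.of_norm (by simpa only [norm_term] using ha)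
      have hs2 : HasSum (fun k : ℤ => a k * Complex.exp (θ * Complex.I) ^ k) (g a θ) := hs.hasSum
      exact hs2.mul_left (Complex.exp (((n : ℂ) + 1) * θ * Complex.I))
  have h2 : HasSum (fun k : ℤ => if k = -n - 1 then 2 * Real.pi * a (-n - 1) else 0)
      (2 * Real.pi * a (-n - 1)) := hasSum_ite_eq _ _
  refine h1.unique ?_
  convert h2 using 2 with k
  have e : ∀ θ : ℝ, Complex.exp (((n : ℂ) + 1) * θ * Complex.I) *
      (a k * Complex.exp (θ * Complex.I) ^ k)
      = a k * Complex.exp (((n + 1 + k : ℤ) * Complex.I) * θ) := by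
    intro θ
    rw [← Complex.exp_int_mul, mul_left_comm, ← Complex.exp_add]
    congr 2
    push_cast
    ring
  simp only [e]
  rw [intervalIntegral.integral_const_mul]
  split_ifs with hk
  · subst hk
    simp
    ring
  · have hne : n + 1 + k ≠ 0 := by omega
    rw [integral_exp_mul_complex (mul_ne_zero (by exact_mod_cast hne) Complex.I_ne_zero)]
    have : Complex.exp (((n + 1 + k : ℤ) * Complex.I) * (Real.pi : ℝ))
        = Complex.exp (((n + 1 + k : ℤ) * Complex.I) * ((-Real.pi : ℝ) : ℂ)) := by
      rw [Complex.exp_eq_exp_iff_exists_int]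
      refine ⟨n + 1 + k, ?_⟩
      push_cast
      ring
    rw [this]
    simp

section
variable [CompleteSpace X] (T : X →L[ℂ] X) (a : ℤ → ℂ) (ha : Summable fun k : ℤ => ‖a k‖)
    (U : Set ℂ) (hU : IsOpen U)
    (hspecU : spectrum ℂ T ∩ {z : ℂ | ‖z‖ = 1} ⊆ U)
    (hvanish : ∀ z ∈ U, ‖z‖ = 1 → ∑' k : ℤ, a k * z ^ k = 0)

lemma h_mul (hspecU : spectrum ℂ T ∩ {z : ℂ | ‖z‖ = 1} ⊆ U)
    (hvanish : ∀ z ∈ U, ‖z‖ = 1 → ∑' k : ℤ, a k * z ^ k = 0) (θ : ℝ) :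
    Complex.exp (θ * Complex.I) • h T a θ = T * h T a θ + g a θ • 1 := by
  by_cases hθ : Complex.exp (θ * Complex.I) ∈ U
  · have : g a θ = 0 := hvanish _ hθ (Complex.norm_exp_ofReal_mul_I θ)
    simp [h, this]
  · have hu : IsUnit (algebraMap ℂ (X →L[ℂ] X) (Complex.exp (θ * Complex.I)) - T) := by
      by_contra hc
      exact hθ (hspecU ⟨hc, Complex.norm_exp_ofReal_mul_I θ⟩)
    have h1 := Ring.mul_inverse_cancel _ hu
    rw [sub_mul, ← Algebra.smul_def, sub_eq_iff_eq_add] at h1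
    unfold h
    rw [smul_comm, h1, smul_add, mul_smul_comm, add_comm]

lemma h_continuous (ha : Summable fun k : ℤ => ‖a k‖) (hU : IsOpen U)
    (hspecU : spectrum ℂ T ∩ {z : ℂ | ‖z‖ = 1} ⊆ U)
    (hvanish : ∀ z ∈ U, ‖z‖ = 1 → ∑' k : ℤ, a k * z ^ k = 0) :
    Continuous (h T a) := by
  rw [continuous_iff_continuousAt]
  intro θ
  have hc : Continuous fun θ : ℝ => Complex.exp (θ * Complex.I) := by fun_prop
  by_cases hθ : Complex.exp (θ * Complex.I) ∈ U
  · have : h T a =ᶠ[𝓝 θ] fun _ => 0 := by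
      filter_upwards [hc.continuousAt.preimage_mem_nhds (hU.mem_nhds hθ)] with t ht
      have : g a t = 0 := hvanish _ ht (Complex.norm_exp_ofReal_mul_I t)
      simp [h, this]
    exact continuousAt_const.congr this.symm
  · have hu : IsUnit (algebraMap ℂ (X →L[ℂ] X) (Complex.exp (θ * Complex.I)) - T) := by
      by_contra hc
      exact hθ (hspecU ⟨hc, Complex.norm_exp_ofReal_mul_I θ⟩)
    obtain ⟨u, hu⟩ := hu
    have h1 := NormedRing.inverse_continuousAt u
    rw [hu] at h1
    have h2 : ContinuousAt (fun t : ℝ =>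
        algebraMap ℂ (X →L[ℂ] X) (Complex.exp (t * Complex.I)) - T) θ :=
      (((continuous_algebraMap ℂ (X →L[ℂ] X)).comp hc).sub continuous_const).continuousAt
    exact (g_continuous a ha).continuousAt.smul (ContinuousAt.comp (f := fun t : ℝ =>
        algebraMap ℂ (X →L[ℂ] X) (Complex.exp (t * Complex.I)) - T) h1 h2)

lemma J_succ (ha : Summable fun k : ℤ => ‖a k‖) (hU : IsOpen U)
    (hspecU : spectrum ℂ T ∩ {z : ℂ | ‖z‖ = 1} ⊆ U)
    (hvanish : ∀ z ∈ U, ‖z‖ = 1 → ∑' k : ℤ, a k * z ^ k = 0) (n : ℤ) :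
    J T a (n + 1) = T * J T a n + a (-n - 1) • 1 := by
  have hc := h_continuous T a U ha hU hspecU hvanish
  have hg := g_continuous a ha
  have e : ∀ θ : ℝ, Complex.exp ((((n + 1 : ℤ) : ℂ) + 1) * θ * Complex.I) • h T a θ
      = T * (Complex.exp (((n : ℂ) + 1) * θ * Complex.I) • h T a θ)
        + (Complex.exp (((n : ℂ) + 1) * θ * Complex.I) * g a θ) • (1 : X →L[ℂ] X) := by
    intro θ
    have : Complex.exp ((((n + 1 : ℤ) : ℂ) + 1) * θ * Complex.I)
      = Complex.exp (((n : ℂ) + 1) * θ * Complex.I) * Complex.exp (θ * Complex.I) := by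
      rw [← Complex.exp_add]
      congr 1
      push_cast
      ring
    rw [this, mul_smul, h_mul T a U hspecU hvanish, smul_add, mul_smul_comm, mul_smul]
  have hE : Continuous fun θ : ℝ => Complex.exp (((n : ℂ) + 1) * θ * Complex.I) := by fun_prop
  have hi : IntervalIntegrable (fun θ : ℝ =>
      Complex.exp (((n : ℂ) + 1) * θ * Complex.I) • h T a θ) MeasureTheory.volume
      (-Real.pi) Real.pi := (hE.smul hc).intervalIntegrable _ _
  unfold J
  simp only [e]
  rw [intervalIntegral.integral_add]
  · rw [intervalIntegral.integral_smul_const, g_integral a ha, smul_add, mul_smul_comm]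
    congr 1
    · congr 1
      exact (ContinuousLinearMap.mul ℂ (X →L[ℂ] X) T).intervalIntegral_comp_comm hi
    · rw [← smul_assoc]
      congr 1
      have : (Real.pi : ℂ) ≠ 0 := by exact_mod_cast Real.pi_ne_zero
      rw [Complex.real_smul]
      push_cast
      field_simp
  · exact (continuous_const.mul (hE.smul hc)).intervalIntegrable _ _
  · exact ((hE.mul hg).smul continuous_const).intervalIntegrable _ _

lemma S_eq_J {K : ℝ} (hK : ∀ n : ℕ, ‖T ^ n‖ ≤ K) (ha : Summable fun k : ℤ => ‖a k‖)
    (hU : IsOpen U)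
    (hspecU : spectrum ℂ T ∩ {z : ℂ | ‖z‖ = 1} ⊆ U)
    (hvanish : ∀ z ∈ U, ‖z‖ = 1 → ∑' k : ℤ, a k * z ^ k = 0) (n : ℤ) :
    S T a n = J T a n := by
  have hD : ∀ m : ℤ, S T a (m + 1) - J T a (m + 1) = T * (S T a m - J T a m) := by
    intro m
    rw [S_succ T hK a ha, J_succ T a U ha hU hspecU hvanish, mul_sub]
    abel
  have hD2 : ∀ m : ℕ, ∀ n : ℤ, S T a n - J T a n
      = T ^ m * (S T a (n - m) - J T a (n - m)) := by
    intro m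
    induction m with
    | zero => intro n; simp
    | succ m ih =>
      intro n
      have := hD (n - (m + 1 : ℕ))
      rw [ih, pow_succ, mul_assoc, ← this]
      congr 3 <;> (congr 1; push_cast; ring)
  have hJ : Tendsto (J T a) atBot (𝓝 0) := (J_tendsto T a).mono_left atBot_le_cofinite
  have hl := ((S_tendsto T hK a ha).sub hJ).norm.const_mul K
  have hm : Tendsto (fun m : ℕ => n - (m : ℤ)) atTop atBot :=
    tendsto_atBot_add_const_left _ n
      (tendsto_neg_atTop_atBot.comp tendsto_natCast_atTop_atTop)
  have hl2 := hl.comp hm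
  simp only [sub_zero, norm_zero, mul_zero] at hl2
  have : ‖S T a n - J T a n‖ ≤ 0 := by
    refine ge_of_tendsto' hl2 fun m => ?_
    rw [hD2 m n]
    exact (norm_mul_le _ _).trans (mul_le_mul_of_nonneg_right (hK m) (norm_nonneg _))
  exact sub_eq_zero.1 (norm_le_zero_iff.1 this)

end

end KT

/-- First step of the Fourier-analytic proof of the Katznelson–Tzafriri theorem: if
`g(z) = Σ_k a_k z^k` (with `(a_k) ∈ ℓ¹(ℤ)`) vanishes on an open neighbourhood of the
unitary spectrum of a power-bounded operator `T`, then (interpreting `T^m = 0` for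
`m < 0`)
`Σ_k a_k T^{n+k} = (2π)⁻¹ ∫_{-π}^{π} e^{i(n+1)θ} g(e^{iθ}) (e^{iθ}I - T)⁻¹ dθ`
for every `n ≥ 0`, and `‖Σ_k a_k T^{n+k}‖ → 0` as `n → ∞`. -/
theorem stmt19 {X : Type*} [NormedAddCommGroup X] [NormedSpace ℂ X] [CompleteSpace X]
    (T : X →L[ℂ] X) (hpb : ∃ K : ℝ, ∀ n : ℕ, ‖T ^ n‖ ≤ K)
    (a : ℤ → ℂ) (ha : Summable fun k : ℤ => ‖a k‖)
    (U : Set ℂ) (hU : IsOpen U)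
    (hspecU : spectrum ℂ T ∩ {z : ℂ | ‖z‖ = 1} ⊆ U)
    (hvanish : ∀ z ∈ U, ‖z‖ = 1 → ∑' k : ℤ, a k * z ^ k = 0) :
    (∀ n : ℕ,
      (∑' k : ℤ, a k • (if 0 ≤ (n : ℤ) + k then T ^ ((n : ℤ) + k).toNat else 0)) =
        (2 * Real.pi)⁻¹ •
          ∫ θ in (-Real.pi)..Real.pi,
            (Complex.exp (((n : ℂ) + 1) * θ * Complex.I) *
                ∑' k : ℤ, a k * Complex.exp (θ * Complex.I) ^ k) •
              Ring.inverse
                (algebraMap ℂ (X →L[ℂ] X) (Complex.exp (θ * Complex.I)) - T)) ∧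
    Tendsto
      (fun n : ℕ =>
        ‖∑' k : ℤ, a k • (if 0 ≤ (n : ℤ) + k then T ^ ((n : ℤ) + k).toNat else 0)‖)
      atTop (𝓝 0) := by
  obtain ⟨K, hK⟩ := hpb
  have key := KT.S_eq_J T a U hK ha hU hspecU hvanish
  refine ⟨fun n => ?_, ?_⟩
  · have := key n
    simpa only [KT.S, KT.P, KT.J, KT.h, KT.g, smul_smul, Int.cast_natCast] using this
  · have h1 : Tendsto (fun n : ℕ => KT.S T a (n : ℤ)) atTop (𝓝 0) := by
      simp only [key]
      have := (KT.J_tendsto T a).comp (Nat.cast_injective (R := ℤ)).tendsto_cofinite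
      rwa [Nat.cofinite_eq_atTop] at this
    simpa only [norm_zero, KT.S, KT.P] using h1.norm
end
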